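/- Let γ ∈ [0,∞)^d and z ∈ 𝕋^{(d)}. Then for every f ∈ S(ℝ^d₊): (a) J_{z,γ} f ∈ S(ℝ^d₊); (b) J_{z,γ} preserves the weighted L² norm, i.e. ∫_{ℝ^d₊} |J_{z,γ} f(t)|² t^γ dt = ∫_{ℝ^d₊} |f(t)|² t^γ dt; (c) for γ = 0, J_{z̄,0}(J_{z,0} f) = f on ℝ^d₊, where z̄ = (z̄₁,…,z̄_d). -/

import Mathlib

open MeasureTheory Filter Finset

noncomputable section

def Rpos (d : ℕ) : Set (Fin d → ℝ) := {x | ∀ i, 0 < x i}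

def pd {d : ℕ} (i : Fin d) (f : (Fin d → ℝ) → ℂ) : (Fin d → ℝ) → ℂ :=
  fun x => fderiv ℝ f x (Pi.single i 1)

def mderiv {d : ℕ} (p : Fin d → ℕ) (f : (Fin d → ℝ) → ℂ) : (Fin d → ℝ) → ℂ :=
  ((List.ofFn fun i : Fin d => (fun g => (pd i)^[p i] g)).foldr (· ∘ ·) id) f

/-- The space `S(ℝ^d₊)`. -/
def IsSPlus {d : ℕ} (f : (Fin d → ℝ) → ℂ) : Prop :=
  ContDiffOn ℝ (⊤ : ℕ∞) f (Rpos d) ∧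
  (∀ p : Fin d → ℕ, ∃ g : (Fin d → ℝ) → ℂ,
    ContinuousOn g {x | ∀ i, 0 ≤ x i} ∧ ∀ x ∈ Rpos d, g x = mderiv p f x) ∧
  (∀ k p : Fin d → ℕ, ∃ C : ℝ, ∀ x ∈ Rpos d,
    (∏ i, x i ^ k i) * ‖mderiv p f x‖ ≤ C)

/-- The entire function `K_γ(u) = ∑ u^k/(k! Γ(k+γ+1))`. -/
def Kfun (γ : ℝ) (u : ℂ) : ℂ :=
  ∑' k : ℕ, u ^ k / ((k.factorial : ℂ) * Complex.Gamma ((k : ℂ) + (γ : ℂ) + 1))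

/-- Modified fractional power of the Hankel-Clifford transform of order `γ`:
`J_{z,γ} f(t) = ∏ (1−z_l)^{−1−γ_l} ∫_{ℝ^d₊} f(x) ∏ x_l^{γ_l} K_{γ_l}(x_l t_l z_l/(1−z_l)²) dx`. -/
def Jtrans {d : ℕ} (z : Fin d → ℂ) (γ : Fin d → ℝ) (f : (Fin d → ℝ) → ℂ) :
    (Fin d → ℝ) → ℂ :=
  fun t => (∏ l, (1 - z l) ^ ((-1 : ℂ) - (γ l : ℂ))) *
    ∫ x in Rpos d, f x *
      ∏ l, ((x l : ℂ) ^ ((γ l : ℂ)) * Kfun (γ l) ((x l : ℂ) * (t l : ℂ) * z l / (1 - z l)^2))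

section

variable {d : ℕ}

/-- The real kernel `u ↦ K_γ(-u)`. -/
def kerR (γ u : ℝ) : ℝ :=
  ∑' k : ℕ, (-u) ^ k / ((k.factorial : ℝ) * Real.Gamma ((k : ℝ) + γ + 1))

lemma Gamma_le_Gamma_nat_add {γ : ℝ} (hγ : 0 ≤ γ) (k : ℕ) :
    Real.Gamma (γ + 1) ≤ Real.Gamma ((k : ℝ) + γ + 1) := by
  induction k with
  | zero => simp
  | succ k ih =>
    have hk : (0 : ℝ) ≤ k := k.cast_nonneg
    have h : Real.Gamma (((k + 1 : ℕ) : ℝ) + γ + 1)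
        = ((k : ℝ) + γ + 1) * Real.Gamma ((k : ℝ) + γ + 1) := by
      rw [← Real.Gamma_add_one (by positivity)]; congr 1; push_cast; ring
    have hpos : 0 < Real.Gamma ((k : ℝ) + γ + 1) := Real.Gamma_pos_of_pos (by positivity)
    rw [h]; nlinarith

lemma norm_kerR_term_le {γ : ℝ} (hγ : 0 ≤ γ) (u : ℝ) (k : ℕ) :
    ‖(-u) ^ k / ((k.factorial : ℝ) * Real.Gamma ((k : ℝ) + γ + 1))‖
      ≤ (|u| ^ k / k.factorial) * (Real.Gamma (γ + 1))⁻¹ := by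
  have h1 : 0 < Real.Gamma (γ + 1) := Real.Gamma_pos_of_pos (by positivity)
  have h2 := Gamma_le_Gamma_nat_add hγ k
  have h3 : 0 < (k.factorial : ℝ) := by positivity
  rw [norm_div, norm_pow, norm_neg, Real.norm_eq_abs, norm_mul, Real.norm_of_nonneg h3.le,
    Real.norm_of_nonneg (h1.le.trans h2), ← div_div, ← div_eq_mul_inv]
  gcongr

lemma summable_kerR {γ : ℝ} (hγ : 0 ≤ γ) (u : ℝ) :
    Summable fun k : ℕ => (-u) ^ k / ((k.factorial : ℝ) * Real.Gamma ((k : ℝ) + γ + 1)) :=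
  Summable.of_norm_bounded ((Real.summable_pow_div_factorial |u|).mul_right _)
    (norm_kerR_term_le hγ u)

lemma Kfun_neg (γ u : ℝ) : Kfun γ (-(u : ℂ)) = (kerR γ u : ℂ) := by
  unfold Kfun kerR
  rw [Complex.ofReal_tsum]
  refine tsum_congr fun k => ?_
  push_cast
  rw [← Complex.ofReal_natCast k, ← Complex.ofReal_add, ← Complex.ofReal_one,
    ← Complex.ofReal_add, Complex.Gamma_ofReal]

lemma kerR_zero (γ : ℝ) : kerR γ 0 = (Real.Gamma (γ + 1))⁻¹ := by
  unfold kerR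
  rw [tsum_eq_single 0 (by intro k hk; simp [hk])]
  simp

lemma hasDerivAt_kerR {γ : ℝ} (hγ : 0 ≤ γ) (u : ℝ) :
    HasDerivAt (kerR γ) (-kerR (γ + 1) u) u := by
  have hterm : ∀ (n : ℕ) (y : ℝ), HasDerivAt
      (fun y : ℝ => (-y) ^ n / ((n.factorial : ℝ) * Real.Gamma ((n : ℝ) + γ + 1)))
      (-(n * (-y) ^ (n - 1)) / ((n.factorial : ℝ) * Real.Gamma ((n : ℝ) + γ + 1))) y := by
    intro n y
    refine HasDerivAt.div_const ?_ _
    have h := (hasDerivAt_neg y).pow n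
    simp only [mul_neg, mul_one] at h
    exact h
  have hsucc : ∀ (n : ℕ) (y : ℝ),
      -((n + 1 : ℕ) * (-y) ^ (n + 1 - 1)) /
        (((n + 1).factorial : ℝ) * Real.Gamma (((n + 1 : ℕ) : ℝ) + γ + 1))
      = -((-y) ^ n / ((n.factorial : ℝ) * Real.Gamma ((n : ℝ) + (γ + 1) + 1))) := by
    intro n y
    have h : (((n + 1 : ℕ) : ℝ) + γ + 1) = (n : ℝ) + (γ + 1) + 1 := by push_cast; ring
    have h3 : 0 < (n.factorial : ℝ) := by positivity
    have h4 : 0 < Real.Gamma ((n : ℝ) + (γ + 1) + 1) := Real.Gamma_pos_of_pos (by positivity)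
    rw [h, Nat.factorial_succ, Nat.add_sub_cancel]
    push_cast
    field_simp
  set R := |u| + 1
  set v : ℕ → ℝ := fun n => match n with
    | 0 => 0
    | n + 1 => (R ^ n / n.factorial) * (Real.Gamma (γ + 1 + 1))⁻¹
  have hv : Summable v := by
    rw [← summable_nat_add_iff 1]
    exact (Real.summable_pow_div_factorial R).mul_right _
  have hmem : u ∈ Metric.ball (0 : ℝ) R := by simp [R]
  have key := hasDerivAt_tsum_of_isPreconnected hv Metric.isOpen_ball
    (convex_ball (0 : ℝ) R).isPreconnected (fun n y _ => hterm n y) (fun n y hy => ?_) hmem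
    (summable_kerR hγ u) hmem
  · convert! key using 1
    rw [Summable.tsum_eq_zero_add]
    · simp only [hsucc]
      simp [kerR, tsum_neg]
    · rw [← summable_nat_add_iff 1]
      simp only [hsucc]
      exact (summable_kerR (by positivity) u).neg
  · cases n with
    | zero => simp [v]
    | succ n =>
      rw [hsucc, norm_neg]
      refine (norm_kerR_term_le (by positivity) y n).trans ?_
      have : |y| ≤ R := by simpa using (Metric.mem_ball.1 hy).le
      have : 0 ≤ (Real.Gamma (γ + 1 + 1))⁻¹ := inv_nonneg.2 (Real.Gamma_nonneg_of_nonneg (by positivity))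
      simp only [v]
      gcongr

lemma continuous_kerR {γ : ℝ} (hγ : 0 ≤ γ) : Continuous (kerR γ) :=
  continuous_iff_continuousAt.2 fun u => (hasDerivAt_kerR hγ u).continuousAt

/-- The Bessel-type recurrence for the kernel. -/
lemma kerR_recurrence {γ : ℝ} (hγ : 0 ≤ γ) (u : ℝ) :
    kerR γ u = (γ + 1) * kerR (γ + 1) u - u * kerR (γ + 2) u := by
  have h1 : 0 ≤ γ + 1 := by positivity
  have h2 : 0 ≤ γ + 2 := by positivity
  have hsum : (Summable fun n : ℕ => (n : ℝ) * ((-u) ^ n / ((n.factorial : ℝ) *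
      Real.Gamma ((n : ℝ) + (γ + 1) + 1)))) ∧
      -u * kerR (γ + 2) u = ∑' n : ℕ, ((n : ℝ) * ((-u) ^ n / ((n.factorial : ℝ) *
      Real.Gamma ((n : ℝ) + (γ + 1) + 1)))) := by
    have h : ∀ n : ℕ, ((n + 1 : ℕ) : ℝ) * ((-u) ^ (n + 1) / (((n + 1).factorial : ℝ) *
      Real.Gamma (((n + 1 : ℕ) : ℝ) + (γ + 1) + 1))) =
      -u * ((-u) ^ n / ((n.factorial : ℝ) * Real.Gamma ((n : ℝ) + (γ + 2) + 1))) := by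
      intro n
      have h : (((n + 1 : ℕ) : ℝ) + (γ + 1) + 1) = (n : ℝ) + (γ + 2) + 1 := by push_cast; ring
      have h3 : 0 < (n.factorial : ℝ) := by positivity
      have h4 : 0 < Real.Gamma ((n : ℝ) + (γ + 2) + 1) := Real.Gamma_pos_of_pos (by positivity)
      rw [h, Nat.factorial_succ, pow_succ]
      push_cast
      field_simp
    have hs : Summable fun n : ℕ => (n : ℝ) * ((-u) ^ n / ((n.factorial : ℝ) *
        Real.Gamma ((n : ℝ) + (γ + 1) + 1))) := by
      rw [← summable_nat_add_iff 1]
      simp only [h]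
      exact (summable_kerR h2 u).mul_left _
    refine ⟨hs, ?_⟩
    rw [hs.tsum_eq_zero_add]
    simp only [h]
    rw [tsum_mul_left]
    simp [kerR]
  have e : (γ + 1) * kerR (γ + 1) u - u * kerR (γ + 2) u
      = (γ + 1) * kerR (γ + 1) u + -u * kerR (γ + 2) u := by ring
  rw [e, hsum.2]
  unfold kerR
  rw [← tsum_mul_left, ← Summable.tsum_add ((summable_kerR h1 u).mul_left _) hsum.1]
  refine tsum_congr fun n => ?_
  have h3 : 0 < (n.factorial : ℝ) := by positivity
  have h4 : 0 < Real.Gamma ((n : ℝ) + γ + 1) := Real.Gamma_pos_of_pos (by positivity)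
  have h5 : Real.Gamma ((n : ℝ) + (γ + 1) + 1)
      = ((n : ℝ) + γ + 1) * Real.Gamma ((n : ℝ) + γ + 1) := by
    rw [← Real.Gamma_add_one (by positivity)]; congr 1; ring
  have h6 : (n : ℝ) + γ + 1 ≠ 0 := by positivity
  rw [h5]
  field_simp
  ring

/-- The kernel is bounded on the half-line. -/
lemma abs_kerR_le {γ : ℝ} (hγ : 0 ≤ γ) {u : ℝ} (hu : 0 ≤ u) :
    |kerR γ u| ≤ (Real.Gamma (γ + 1))⁻¹ := by
  have h1 : 0 ≤ γ + 1 := by positivity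
  set E : ℝ → ℝ := fun u => kerR γ u ^ 2 + u * kerR (γ + 1) u ^ 2
  have hE : ∀ u, HasDerivAt E (-(2 * γ + 1) * kerR (γ + 1) u ^ 2) u := by
    intro u
    have a := (hasDerivAt_kerR hγ u).pow 2
    have b := (hasDerivAt_id u).mul ((hasDerivAt_kerR h1 u).pow 2)
    refine (a.add b).congr_deriv ?_
    have := kerR_recurrence hγ u
    have e : γ + 1 + 1 = γ + 2 := by ring
    simp only [e, this, Pi.pow_apply, id]
    push_cast
    ring
  have hanti : AntitoneOn E (Set.Ici 0) := by
    refine antitoneOn_of_deriv_nonpos (convex_Ici 0)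
      (fun x _ => (hE x).continuousAt.continuousWithinAt)
      (fun x _ => (hE x).differentiableAt.differentiableWithinAt) fun x _ => ?_
    rw [(hE x).deriv]
    nlinarith [sq_nonneg (kerR (γ + 1) x)]
  have h := hanti (Set.mem_Ici.2 le_rfl) (Set.mem_Ici.2 hu) hu
  have hpos : 0 < (Real.Gamma (γ + 1))⁻¹ := inv_pos.2 (Real.Gamma_pos_of_pos (by positivity))
  refine abs_le_of_sq_le_sq ?_ hpos.le
  simp only [E, kerR_zero] at h
  nlinarith [mul_nonneg hu (sq_nonneg (kerR (γ + 1) u))]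

/-- The Laplace-type integral of the kernel against an exponential. -/
lemma integral_exp_mul_kerR {γ : ℝ} (hγ : 0 ≤ γ) {a s : ℝ} (ha : 0 < a) :
    ∫ x in Set.Ioi (0 : ℝ), Real.exp (-(a * x)) * (x ^ γ * kerR γ (x * s))
      = a ^ (-1 - γ) * Real.exp (-(s / a)) := by
  set F : ℕ → ℝ → ℝ := fun k x => ((-s) ^ k / ((k.factorial : ℝ) *
    Real.Gamma ((k : ℝ) + γ + 1))) * (x ^ ((k : ℝ) + γ + 1 - 1) * Real.exp (-(a * x)))
  have hG : ∀ k : ℕ, 0 < Real.Gamma ((k : ℝ) + γ + 1) :=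
    fun k => Real.Gamma_pos_of_pos (by positivity)
  have hInt : ∀ k : ℕ, ∫ x in Set.Ioi (0 : ℝ), x ^ ((k : ℝ) + γ + 1 - 1) * Real.exp (-(a * x))
      = (1 / a) ^ ((k : ℝ) + γ + 1) * Real.Gamma ((k : ℝ) + γ + 1) :=
    fun k => Real.integral_rpow_mul_exp_neg_mul_Ioi (by positivity) ha
  have hI : ∀ k : ℕ, IntegrableOn (fun x : ℝ => x ^ ((k : ℝ) + γ + 1 - 1) * Real.exp (-(a * x)))
      (Set.Ioi 0) := fun k => by
    by_contra h
    have := hInt k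
    rw [integral_undef h] at this
    have : 0 < (1 / a) ^ ((k : ℝ) + γ + 1) * Real.Gamma ((k : ℝ) + γ + 1) :=
      mul_pos (by positivity) (hG k)
    linarith
  have hpow : ∀ k : ℕ, (1 / a) ^ ((k : ℝ) + γ + 1) = a ^ (-1 - γ) * (1 / a) ^ k := by
    intro k
    rw [show (k : ℝ) + γ + 1 = -(-1 - γ) + k by ring, Real.rpow_add (by positivity),
      Real.rpow_natCast, one_div, Real.inv_rpow ha.le, Real.rpow_neg ha.le, inv_inv]
  have hF : HasSum (fun k => ∫ x in Set.Ioi (0 : ℝ), F k x)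
      (∫ x in Set.Ioi (0 : ℝ), ∑' k, F k x) := by
    refine hasSum_integral_of_summable_integral_norm (fun k => (hI k).const_mul _) ?_
    have : ∀ k : ℕ, ∫ x in Set.Ioi (0 : ℝ), ‖F k x‖
        = a ^ (-1 - γ) * ((|s| / a) ^ k / k.factorial) := by
      intro k
      have : ∀ x ∈ Set.Ioi (0 : ℝ), ‖F k x‖ = (|s| ^ k / ((k.factorial : ℝ) *
          Real.Gamma ((k : ℝ) + γ + 1))) * (x ^ ((k : ℝ) + γ + 1 - 1) * Real.exp (-(a * x))) := by
        intro x hx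
        have hx : 0 < x := hx
        rw [norm_mul, norm_div, norm_pow, norm_neg, Real.norm_eq_abs s,
          Real.norm_of_nonneg (mul_pos (by positivity) (hG k)).le,
          Real.norm_of_nonneg (r := _ * Real.exp _) (by positivity)]
      rw [setIntegral_congr_fun measurableSet_Ioi this, integral_const_mul, hInt, hpow]
      have := (hG k).ne'
      simp only [div_pow, one_pow]
      field_simp
    simp only [this]
    exact (Real.summable_pow_div_factorial _).mul_left _
  have h1 : ∀ x ∈ Set.Ioi (0 : ℝ), ∑' k, F k x
      = Real.exp (-(a * x)) * (x ^ γ * kerR γ (x * s)) := by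
    intro x hx
    have hx : 0 < x := hx
    unfold kerR
    rw [← tsum_mul_left, ← tsum_mul_left]
    refine tsum_congr fun k => ?_
    simp only [F]
    rw [show (k : ℝ) + γ + 1 - 1 = γ + k by ring, Real.rpow_add hx, Real.rpow_natCast,
      show -(x * s) = x * (-s) by ring, mul_pow]
    ring
  have h2 : ∀ k, ∫ x in Set.Ioi (0 : ℝ), F k x
      = a ^ (-1 - γ) * ((-(s / a)) ^ k / k.factorial) := by
    intro k
    simp only [F]
    have := (hG k).ne'
    rw [integral_const_mul, hInt, hpow, ← neg_div]
    simp only [div_pow, one_pow]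
    field_simp
  rw [setIntegral_congr_fun measurableSet_Ioi h1] at hF
  rw [← hF.tsum_eq]
  simp only [h2]
  rw [tsum_mul_left, Real.exp_eq_exp_ℝ, NormedSpace.exp_eq_tsum_div]

lemma isOpen_Rpos (d : ℕ) : IsOpen (Rpos d) := by
  have : Rpos d = Set.pi Set.univ fun _ => Set.Ioi 0 := by ext x; simp [Rpos]
  rw [this]
  exact isOpen_set_pi Set.finite_univ fun _ _ => isOpen_Ioi

/-- Iterated partial derivatives along a list of directions. -/
def pdl {d : ℕ} : List (Fin d) → ((Fin d → ℝ) → ℂ) → (Fin d → ℝ) → ℂ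
  | [], f => f
  | m :: L, f => pdl L (pd m f)

lemma pd_congr {f g : (Fin d → ℝ) → ℂ} (h : Set.EqOn f g (Rpos d)) (m : Fin d) :
    Set.EqOn (pd m f) (pd m g) (Rpos d) := fun x hx => by
  have : f =ᶠ[nhds x] g := h.eventuallyEq_of_mem ((isOpen_Rpos d).mem_nhds hx)
  simp [pd, this.fderiv_eq]

lemma pdl_congr (L : List (Fin d)) : ∀ {f g : (Fin d → ℝ) → ℂ}, Set.EqOn f g (Rpos d) →
    Set.EqOn (pdl L f) (pdl L g) (Rpos d) := by
  induction L with
  | nil => exact fun h => h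
  | cons m L ih => exact fun h => ih (pd_congr h m)

lemma pdl_append (L M : List (Fin d)) : ∀ f, pdl (L ++ M) f = pdl M (pdl L f) := by
  induction L with
  | nil => exact fun _ => rfl
  | cons m L ih => exact fun f => ih _

abbrev SmoothPos (f : (Fin d → ℝ) → ℂ) : Prop := ContDiffOn ℝ (⊤ : ℕ∞) f (Rpos d)

lemma SmoothPos.differentiableAt {f : (Fin d → ℝ) → ℂ} (hf : SmoothPos f) {x : Fin d → ℝ}
    (hx : x ∈ Rpos d) : DifferentiableAt ℝ f x :=
  (ContDiffOn.contDiffAt hf ((isOpen_Rpos d).mem_nhds hx)).differentiableAt (by simp)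

lemma SmoothPos.pd {f : (Fin d → ℝ) → ℂ} (hf : SmoothPos f) (m : Fin d) :
    SmoothPos (pd m f) :=
  (ContDiffOn.fderiv_of_isOpen hf (isOpen_Rpos d) (by simp)).clm_apply contDiffOn_const

lemma pd_comm {f : (Fin d → ℝ) → ℂ} (hf : SmoothPos f) (a b : Fin d) :
    Set.EqOn (pd a (pd b f)) (pd b (pd a f)) (Rpos d) := fun x hx => by
  have hd : DifferentiableAt ℝ (fderiv ℝ f) x :=
    ((ContDiffOn.fderiv_of_isOpen hf (isOpen_Rpos d) (m := (⊤ : ℕ∞)) (by simp)).contDiffAt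
      ((isOpen_Rpos d).mem_nhds hx)).differentiableAt (by simp)
  have h : ∀ a b : Fin d, pd a (pd b f) x
      = fderiv ℝ (fderiv ℝ f) x (Pi.single a 1) (Pi.single b 1) := fun a b => by
    unfold pd
    rw [fderiv_clm_apply hd (differentiableAt_const _)]
    simp
  rw [h, h]
  exact ((ContDiffOn.contDiffAt hf ((isOpen_Rpos d).mem_nhds hx)).isSymmSndFDerivAt
    (by simpa using (WithTop.coe_le_coe.2 le_top : ((2 : ℕ∞) : WithTop ℕ∞) ≤ ((⊤ : ℕ∞) : WithTop ℕ∞)))).eq _ _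

lemma pdl_perm {L M : List (Fin d)} (h : L.Perm M) : ∀ {f : (Fin d → ℝ) → ℂ}, SmoothPos f →
    Set.EqOn (pdl L f) (pdl M f) (Rpos d) := by
  induction h with
  | nil => exact fun _ _ _ => rfl
  | cons m _ ih => exact fun hf => ih (hf.pd m)
  | swap a b L => exact fun hf => pdl_congr L (pd_comm hf _ _)
  | trans _ _ h1 h2 => exact fun hf => (h1 hf).trans (h2 hf)

lemma pd_iterate (i : Fin d) (n : ℕ) : ∀ f, (pd i)^[n] f = pdl (List.replicate n i) f := by
  induction n with
  | zero => exact fun _ => rfl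
  | succ n ih => exact fun f => ih _

lemma foldr_comp_pd (p : Fin d → ℕ) (M : List (Fin d)) : ∀ f,
    ((M.map fun i : Fin d => (fun g => (pd i)^[p i] g)).foldr (· ∘ ·) id) f
      = pdl ((M.map fun i => List.replicate (p i) i).reverse.flatten) f := by
  induction M with
  | nil => exact fun _ => rfl
  | cons i M ih =>
    intro f
    rw [List.map_cons, List.foldr_cons, Function.comp_apply, ih, pd_iterate, List.map_cons,
      List.reverse_cons, List.flatten_append, pdl_append]
    simp

lemma exists_mderiv_eq_pdl (L : List (Fin d)) {f : (Fin d → ℝ) → ℂ} (hf : SmoothPos f) :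
    ∃ p, Set.EqOn (mderiv p f) (pdl L f) (Rpos d) := by
  refine ⟨fun i => L.count i, ?_⟩
  have h : mderiv (fun i => L.count i) f = pdl (((List.finRange d).map fun i =>
      List.replicate (L.count i) i).reverse.flatten) f := by
    rw [← foldr_comp_pd (fun i => L.count i)]
    simp [mderiv, List.ofFn_eq_map]
  rw [h]
  refine pdl_perm (List.perm_iff_count.2 fun a => ?_) hf
  rw [List.count_flatten, List.map_reverse, List.sum_reverse, List.map_map]
  have : (List.count a ∘ fun i => List.replicate (List.count i L) i)
      = fun i => if i = a then L.count a else 0 := by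
    ext i
    by_cases h : i = a <;> simp [List.count_replicate, h]
  rw [this, ← List.ofFn_eq_map, List.sum_ofFn]
  simp

/-- Smooth functions on the open orthant all of whose derivatives decay rapidly. -/
structure IsRapid (f : (Fin d → ℝ) → ℂ) : Prop where
  smooth : SmoothPos f
  decay : ∀ (L : List (Fin d)) (k : Fin d → ℕ), ∃ C : ℝ, ∀ x ∈ Rpos d,
    (∏ i, x i ^ k i) * ‖pdl L f x‖ ≤ C

lemma IsSPlus.isRapid {f : (Fin d → ℝ) → ℂ} (hf : IsSPlus f) : IsRapid f := by
  refine ⟨hf.1, fun L k => ?_⟩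
  obtain ⟨p, hp⟩ := exists_mderiv_eq_pdl L hf.1
  obtain ⟨C, hC⟩ := hf.2.2 k p
  exact ⟨C, fun x hx => by rw [← hp hx]; exact hC x hx⟩

lemma IsRapid.pd {f : (Fin d → ℝ) → ℂ} (hf : IsRapid f) (m : Fin d) : IsRapid (pd m f) :=
  ⟨hf.smooth.pd m, fun L k => hf.decay (m :: L) k⟩

lemma pd_add {f g : (Fin d → ℝ) → ℂ} (hf : SmoothPos f) (hg : SmoothPos g) (m : Fin d) :
    Set.EqOn (pd m (f + g)) (pd m f + pd m g) (Rpos d) := fun x hx => by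
  simp [pd, fderiv_add (hf.differentiableAt hx) (hg.differentiableAt hx)]

lemma pdl_add (L : List (Fin d)) : ∀ {f g : (Fin d → ℝ) → ℂ}, SmoothPos f → SmoothPos g →
    Set.EqOn (pdl L (f + g)) (pdl L f + pdl L g) (Rpos d) := by
  induction L with
  | nil => exact fun _ _ _ _ => rfl
  | cons m L ih =>
    exact fun hf hg => (pdl_congr L (pd_add hf hg m)).trans (ih (hf.pd m) (hg.pd m))

lemma IsRapid.add {f g : (Fin d → ℝ) → ℂ} (hf : IsRapid f) (hg : IsRapid g) :
    IsRapid (f + g) := by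
  refine ⟨hf.smooth.add hg.smooth, fun L k => ?_⟩
  obtain ⟨C, hC⟩ := hf.decay L k
  obtain ⟨D, hD⟩ := hg.decay L k
  refine ⟨C + D, fun x hx => ?_⟩
  rw [pdl_add L hf.smooth hg.smooth hx]
  have : 0 ≤ ∏ i, x i ^ k i := prod_nonneg fun i _ => pow_nonneg (hx i).le _
  calc _ ≤ (∏ i, x i ^ k i) * (‖pdl L f x‖ + ‖pdl L g x‖) := by
        gcongr; exact norm_add_le _ _
    _ ≤ C + D := by rw [mul_add]; exact add_le_add (hC x hx) (hD x hx)

lemma pd_const_mul {f : (Fin d → ℝ) → ℂ} (hf : SmoothPos f) (c : ℂ) (m : Fin d) :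
    Set.EqOn (pd m (fun x => c * f x)) (fun x => c * pd m f x) (Rpos d) := fun x hx => by
  simp [pd, fderiv_const_mul (hf.differentiableAt hx)]

lemma pdl_const_mul (L : List (Fin d)) (c : ℂ) : ∀ {f : (Fin d → ℝ) → ℂ}, SmoothPos f →
    Set.EqOn (pdl L (fun x => c * f x)) (fun x => c * pdl L f x) (Rpos d) := by
  induction L with
  | nil => exact fun _ _ _ => rfl
  | cons m L ih =>
    exact fun hf => (pdl_congr L (pd_const_mul hf c m)).trans (ih (hf.pd m))

lemma IsRapid.const_mul {f : (Fin d → ℝ) → ℂ} (hf : IsRapid f) (c : ℂ) :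
    IsRapid (fun x => c * f x) := by
  refine ⟨contDiffOn_const.mul hf.smooth, fun L k => ?_⟩
  obtain ⟨C, hC⟩ := hf.decay L k
  refine ⟨‖c‖ * C, fun x hx => ?_⟩
  rw [pdl_const_mul L c hf.smooth hx, norm_mul, mul_left_comm]
  gcongr
  exact hC x hx

/-- The `l`-th coordinate as a complex-valued continuous linear map. -/
def coordL (l : Fin d) : (Fin d → ℝ) →L[ℝ] ℂ :=
  Complex.ofRealCLM.comp (ContinuousLinearMap.proj (φ := fun _ : Fin d => ℝ) l)

lemma coordL_apply (l : Fin d) (x : Fin d → ℝ) : coordL l x = (x l : ℂ) := rfl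

lemma pd_coord_mul {f : (Fin d → ℝ) → ℂ} (hf : SmoothPos f) (l m : Fin d) :
    Set.EqOn (pd m (fun x => (x l : ℂ) * f x))
      ((fun x => (if l = m then 1 else 0) * f x) + fun x => (x l : ℂ) * pd m f x) (Rpos d) :=
  fun x hx => by
    have := (coordL l).hasFDerivAt (x := x).mul (hf.differentiableAt hx).hasFDerivAt
    have e : pd m (fun x => (x l : ℂ) * f x) x
        = ((coordL l) x • fderiv ℝ f x + f x • coordL l) (Pi.single m 1) :=
      congrArg (fun A : (Fin d → ℝ) →L[ℝ] ℂ => A (Pi.single m 1)) (HasFDerivAt.fderiv this)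
    rw [e]
    by_cases h : l = m
    · subst h; simp [coordL_apply, pd, add_comm]
    · simp [coordL_apply, pd, h]

lemma SmoothPos.coord_mul {f : (Fin d → ℝ) → ℂ} (hf : SmoothPos f) (l : Fin d) :
    SmoothPos (fun x => (x l : ℂ) * f x) :=
  (coordL l).contDiff.contDiffOn.mul hf

lemma IsRapid.coord_mul {f : (Fin d → ℝ) → ℂ} (hf : IsRapid f) (l : Fin d) :
    IsRapid (fun x => (x l : ℂ) * f x) := by
  refine ⟨hf.smooth.coord_mul l, fun L k => ?_⟩
  induction L generalizing f with
  | nil =>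
    obtain ⟨C, hC⟩ := hf.decay [] (k + Pi.single l 1)
    refine ⟨C, fun x hx => ?_⟩
    convert hC x hx using 1
    simp only [pdl, norm_mul, Complex.norm_real, Real.norm_of_nonneg (hx l).le, Pi.add_apply,
      pow_add, prod_mul_distrib, mul_assoc]
    congr 2
    rw [Finset.prod_eq_single l] <;> simp +contextual
  | cons m L ih =>
    obtain ⟨C, hC⟩ := (hf.const_mul (if l = m then 1 else 0)).decay L k
    obtain ⟨D, hD⟩ := ih (hf.pd m)
    refine ⟨C + D, fun x hx => ?_⟩
    have e := ((pdl_congr L (pd_coord_mul hf.smooth l m)).trans (pdl_add L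
      (contDiffOn_const.mul hf.smooth) ((hf.smooth.pd m).coord_mul l))) hx
    have : 0 ≤ ∏ i, x i ^ k i := prod_nonneg fun i _ => pow_nonneg (hx i).le _
    simp only [pdl]
    rw [e]
    refine (mul_le_mul_of_nonneg_left (norm_add_le _ _) this).trans ?_
    rw [mul_add]
    exact add_le_add (hC x hx) (hD x hx)

/-- The integrable majorant `∏ (1 + x_l²)⁻¹`. -/
def cauchyProd (x : Fin d → ℝ) : ℝ := ∏ i, (1 + x i ^ 2)⁻¹

lemma integrable_cauchyProd : Integrable (cauchyProd (d := d)) :=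
  Integrable.fintype_prod (f := fun _ (s : ℝ) => (1 + s ^ 2)⁻¹) fun _ => integrable_inv_one_add_sq

lemma cauchyProd_le (x : Fin d → ℝ) (l : Fin d) : cauchyProd x ≤ (1 + x l ^ 2)⁻¹ := by
  unfold cauchyProd
  rw [← mul_prod_erase _ _ (mem_univ l)]
  refine mul_le_of_le_one_right (by positivity) (prod_le_one (fun i _ => by positivity) fun i _ => ?_)
  exact inv_le_one_of_one_le₀ (by nlinarith [sq_nonneg (x i)])

lemma cauchyProd_nonneg (x : Fin d → ℝ) : 0 ≤ cauchyProd x :=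
  prod_nonneg fun i _ => by positivity

lemma cauchyProd_le_one (x : Fin d → ℝ) : cauchyProd x ≤ 1 :=
  prod_le_one (fun i _ => by positivity) fun i _ =>
    inv_le_one_of_one_le₀ (by nlinarith [sq_nonneg (x i)])

lemma rpow_mul_one_add_sq_le {γ : ℝ} (hγ : 0 ≤ γ) {N : ℕ} (hN : γ + 2 ≤ N) {x : ℝ} (hx : 0 < x) :
    x ^ γ * (1 + x ^ 2) ≤ 2 * (1 + x ^ N) := by
  rcases le_total x 1 with h | h
  · have h1 : x ^ γ ≤ 1 := Real.rpow_le_one hx.le h hγ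
    have h2 : x ^ 2 ≤ 1 := pow_le_one₀ hx.le h
    have h3 : 0 ≤ x ^ N := by positivity
    have h4 : 0 ≤ x ^ γ := by positivity
    nlinarith
  · have h1 : x ^ γ * x ^ 2 ≤ x ^ N := by
      rw [← Real.rpow_natCast x N, ← Real.rpow_natCast x 2, ← Real.rpow_add hx]
      exact Real.rpow_le_rpow_of_exponent_le h (by exact_mod_cast hN)
    have h2 : 1 ≤ x ^ 2 := one_le_pow₀ h
    have h3 : 0 ≤ x ^ γ := by positivity
    nlinarith

lemma IsRapid.weight_bound {f : (Fin d → ℝ) → ℂ} (hf : IsRapid f) {γ : Fin d → ℝ}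
    (hγ : ∀ l, 0 ≤ γ l) :
    ∃ C, 0 ≤ C ∧ ∀ x ∈ Rpos d, (∏ l, x l ^ γ l) * ‖f x‖ ≤ C * cauchyProd x := by
  choose N hN using fun l => exists_nat_ge (γ l + 2)
  choose C hC using fun s : Finset (Fin d) => hf.decay [] (fun l => if l ∈ s then N l else 0)
  have key : ∀ x ∈ Rpos d, (∏ l, x l ^ γ l) * ‖f x‖ ≤ 2 ^ d * (∑ s, C s) * cauchyProd x := by
    intro x hx
    have h1 : cauchyProd x * ∏ l, (1 + x l ^ 2) = 1 := by
      unfold cauchyProd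
      rw [← prod_mul_distrib]
      refine prod_eq_one fun i _ => ?_
      have : 1 + x i ^ 2 ≠ 0 := by positivity
      field_simp
    have h2 : (∏ l, x l ^ γ l) * ∏ l, (1 + x l ^ 2) ≤ 2 ^ d * ∏ l, (1 + x l ^ N l) := by
      rw [← prod_mul_distrib]
      calc _ ≤ ∏ l, 2 * (1 + x l ^ N l) := by
            refine prod_le_prod (fun i _ => ?_) fun i _ => rpow_mul_one_add_sq_le (hγ i) (hN i) (hx i)
            have := Real.rpow_nonneg (hx i).le (γ i)
            positivity
        _ = _ := by rw [prod_mul_distrib]; simp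
    have h3 : (∏ l, (1 + x l ^ N l)) * ‖f x‖ ≤ ∑ s, C s := by
      rw [prod_one_add, sum_mul, powerset_univ]
      refine sum_le_sum fun s _ => ?_
      convert! hC s x hx using 2
      rw [← prod_subset (subset_univ s)]
      · exact prod_congr rfl fun i hi => by simp [hi]
      · intro i _ hi; simp [hi]
    calc (∏ l, x l ^ γ l) * ‖f x‖
        = ((∏ l, x l ^ γ l) * ∏ l, (1 + x l ^ 2)) * ‖f x‖ * cauchyProd x := by
          linear_combination (-(∏ l, x l ^ γ l) * ‖f x‖) * h1
      _ ≤ (2 ^ d * ∏ l, (1 + x l ^ N l)) * ‖f x‖ * cauchyProd x := by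
          have := cauchyProd_nonneg x
          gcongr
      _ = 2 ^ d * ((∏ l, (1 + x l ^ N l)) * ‖f x‖) * cauchyProd x := by ring
      _ ≤ _ := by
          have := cauchyProd_nonneg x
          gcongr
  refine ⟨|2 ^ d * (∑ s, C s)|, abs_nonneg _, fun x hx => (key x hx).trans ?_⟩
  exact mul_le_mul_of_nonneg_right (le_abs_self _) (cauchyProd_nonneg x)

/-- The product kernel of the Hankel–Clifford transform, weight included. -/
def hk (c γ x t : Fin d → ℝ) : ℝ := ∏ l, (x l ^ γ l * kerR (γ l) (x l * (c l * t l)))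

/-- The Hankel–Clifford transform with frequency parameter `c`. -/
def HT (c γ : Fin d → ℝ) (f : (Fin d → ℝ) → ℂ) (t : Fin d → ℝ) : ℂ :=
  ∫ x in Rpos d, f x * (hk c γ x t : ℂ)

lemma continuous_hk {c γ : Fin d → ℝ} (hγ : ∀ l, 0 ≤ γ l) :
    Continuous fun p : (Fin d → ℝ) × (Fin d → ℝ) => hk c γ p.1 p.2 := by
  refine continuous_finsetProd _ fun l _ => ?_
  refine ((Real.continuous_rpow_const (hγ l)).comp (by fun_prop)).mul
    ((continuous_kerR (hγ l)).comp (by fun_prop))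

/-- The supremum bound of the product kernel. -/
def kerBd (γ : Fin d → ℝ) : ℝ := ∏ l, (Real.Gamma (γ l + 1))⁻¹

lemma abs_hk_le {c γ : Fin d → ℝ} (hc : ∀ l, 0 < c l) (hγ : ∀ l, 0 ≤ γ l) {x t : Fin d → ℝ}
    (hx : x ∈ Rpos d) (ht : ∀ l, 0 ≤ t l) : |hk c γ x t| ≤ kerBd γ * ∏ l, x l ^ γ l := by
  unfold hk kerBd
  rw [abs_prod, ← prod_mul_distrib]
  refine prod_le_prod (fun _ _ => abs_nonneg _) fun l _ => ?_
  have h := Real.rpow_nonneg (hx l).le (γ l)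
  rw [abs_mul, abs_of_nonneg h, mul_comm]
  gcongr
  exact abs_kerR_le (hγ l) (mul_nonneg (hx l).le (mul_nonneg (hc l).le (ht l)))

lemma kerBd_nonneg {γ : Fin d → ℝ} (hγ : ∀ l, 0 ≤ γ l) : 0 ≤ kerBd γ :=
  prod_nonneg fun l _ => inv_nonneg.2 (Real.Gamma_nonneg_of_nonneg (by linarith [hγ l]))

lemma norm_mul_hk_le {c γ : Fin d → ℝ} (hc : ∀ l, 0 < c l) (hγ : ∀ l, 0 ≤ γ l)
    (f : (Fin d → ℝ) → ℂ) {x t : Fin d → ℝ} (hx : x ∈ Rpos d) (ht : ∀ l, 0 ≤ t l) :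
    ‖f x * (hk c γ x t : ℂ)‖ ≤ kerBd γ * ((∏ l, x l ^ γ l) * ‖f x‖) := by
  rw [norm_mul, Complex.norm_real, Real.norm_eq_abs]
  calc _ ≤ ‖f x‖ * (kerBd γ * ∏ l, x l ^ γ l) := by gcongr; exact abs_hk_le hc hγ hx ht
    _ = _ := by ring

lemma IsRapid.hk_bound {f : (Fin d → ℝ) → ℂ} (hf : IsRapid f) {c γ : Fin d → ℝ}
    (hc : ∀ l, 0 < c l) (hγ : ∀ l, 0 ≤ γ l) :
    ∃ C, 0 ≤ C ∧ ∀ x ∈ Rpos d, ∀ t : Fin d → ℝ, (∀ l, 0 ≤ t l) →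
      ‖f x * (hk c γ x t : ℂ)‖ ≤ C * cauchyProd x := by
  obtain ⟨C, hC0, hC⟩ := hf.weight_bound hγ
  refine ⟨kerBd γ * C, mul_nonneg (kerBd_nonneg hγ) hC0, fun x hx t ht => ?_⟩
  refine (norm_mul_hk_le hc hγ f hx ht).trans ?_
  rw [mul_assoc]
  exact mul_le_mul_of_nonneg_left (hC x hx) (kerBd_nonneg hγ)

lemma measurableSet_Rpos (d : ℕ) : MeasurableSet (Rpos d) := (isOpen_Rpos d).measurableSet

lemma IsRapid.aesm {f : (Fin d → ℝ) → ℂ} (hf : IsRapid f) :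
    AEStronglyMeasurable f (volume.restrict (Rpos d)) :=
  hf.smooth.continuousOn.aestronglyMeasurable (measurableSet_Rpos d)

lemma aesm_hk {c γ : Fin d → ℝ} (hγ : ∀ l, 0 ≤ γ l) (t : Fin d → ℝ) (μ : Measure (Fin d → ℝ)) :
    AEStronglyMeasurable (fun x => (hk c γ x t : ℂ)) μ :=
  (Complex.continuous_ofReal.comp ((continuous_hk (c := c) hγ).comp
    (Continuous.prodMk_left t))).aestronglyMeasurable

lemma IsRapid.integrable_mul_hk {f : (Fin d → ℝ) → ℂ} (hf : IsRapid f) {c γ : Fin d → ℝ}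
    (hc : ∀ l, 0 < c l) (hγ : ∀ l, 0 ≤ γ l) {t : Fin d → ℝ} (ht : ∀ l, 0 ≤ t l) :
    IntegrableOn (fun x => f x * (hk c γ x t : ℂ)) (Rpos d) := by
  obtain ⟨C, -, hC⟩ := hf.hk_bound hc hγ
  refine Integrable.mono' (integrable_cauchyProd.integrableOn.const_mul C)
    (hf.aesm.mul (aesm_hk hγ t _)) ?_
  exact (ae_restrict_mem (measurableSet_Rpos d)).mono fun x hx => hC x hx t ht

lemma IsRapid.norm_HT_le {f : (Fin d → ℝ) → ℂ} (hf : IsRapid f) {c γ : Fin d → ℝ}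
    (hc : ∀ l, 0 < c l) (hγ : ∀ l, 0 ≤ γ l) :
    ∃ C, ∀ t : Fin d → ℝ, (∀ l, 0 ≤ t l) → ‖HT c γ f t‖ ≤ C := by
  obtain ⟨C, -, hC⟩ := hf.hk_bound hc hγ
  refine ⟨∫ x in Rpos d, C * cauchyProd x, fun t ht => ?_⟩
  exact norm_integral_le_of_norm_le (integrable_cauchyProd.integrableOn.const_mul C)
    ((ae_restrict_mem (measurableSet_Rpos d)).mono fun x hx => hC x hx t ht)

lemma IsRapid.continuousOn_HT {f : (Fin d → ℝ) → ℂ} (hf : IsRapid f) {c γ : Fin d → ℝ}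
    (hc : ∀ l, 0 < c l) (hγ : ∀ l, 0 ≤ γ l) :
    ContinuousOn (HT c γ f) {t | ∀ l, 0 ≤ t l} := by
  obtain ⟨C, -, hC⟩ := hf.hk_bound hc hγ
  refine continuousOn_of_dominated (fun t _ => hf.aesm.mul (aesm_hk hγ t _))
    (fun t ht => (ae_restrict_mem (measurableSet_Rpos d)).mono fun x hx => hC x hx t ht)
    (integrable_cauchyProd.integrableOn.const_mul C) (.of_forall fun x => ?_)
  exact (continuous_const.mul (Complex.continuous_ofReal.comp ((continuous_hk (c := c) hγ).comp
    (Continuous.prodMk_right x)))).continuousOn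

lemma hk_add_single (c γ x t : Fin d → ℝ) (l : Fin d) : hk c (γ + Pi.single l 1) x t =
      (∏ j ∈ univ.erase l, (x j ^ γ j * kerR (γ j) (x j * (c j * t j)))) *
        (x l ^ (γ l + 1) * kerR (γ l + 1) (x l * (c l * t l))) := by
  unfold hk
  rw [← prod_erase_mul _ _ (mem_univ l)]
  congr 1
  · refine prod_congr rfl fun j hj => ?_
    simp [ne_of_mem_erase hj]
  · simp

lemma hasFDerivAt_hk {c γ : Fin d → ℝ} (hγ : ∀ l, 0 ≤ γ l) {x : Fin d → ℝ}
    (hx : x ∈ Rpos d) (t : Fin d → ℝ) :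
    HasFDerivAt (fun t => (hk c γ x t : ℂ))
      (∑ l, (-(c l : ℂ) * (hk c (γ + Pi.single l 1) x t : ℂ)) • coordL l) t := by
  have h1 : ∀ l ∈ (univ : Finset (Fin d)), HasFDerivAt
      (fun t : Fin d → ℝ => x l ^ γ l * kerR (γ l) (x l * (c l * t l)))
      ((-c l * (x l ^ (γ l + 1) * kerR (γ l + 1) (x l * (c l * t l)))) •
        (ContinuousLinearMap.proj l : (Fin d → ℝ) →L[ℝ] ℝ)) t := by
    intro l _
    have h2 : HasFDerivAt (fun t : Fin d → ℝ => x l * (c l * t l))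
        ((x l * c l) • (ContinuousLinearMap.proj l : (Fin d → ℝ) →L[ℝ] ℝ)) t := by
      have := ((ContinuousLinearMap.proj l : (Fin d → ℝ) →L[ℝ] ℝ).hasFDerivAt (x := t)).const_mul
        (x l * c l)
      refine this.congr_of_eventuallyEq (.of_forall fun t => ?_)
      simp [mul_assoc]
    have h3 := ((hasDerivAt_kerR (hγ l) (x l * (c l * t l))).comp_hasFDerivAt t h2).const_mul
      (x l ^ γ l)
    refine h3.congr_fderiv ?_
    rw [Real.rpow_add_one (hx l).ne', smul_smul, smul_smul]
    congr 1
    ring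
  have h4 := HasFDerivAt.finsetProd h1
  have h5 := Complex.ofRealCLM.hasFDerivAt.comp t h4
  refine HasFDerivAt.congr_fderiv (f := fun t => (hk c γ x t : ℂ)) h5 ?_
  ext v
  simp only [ContinuousLinearMap.comp_apply, _root_.sum_apply,
    _root_.smul_apply, Complex.ofRealCLM_apply, coordL_apply, smul_eq_mul,
    ContinuousLinearMap.proj_apply, hk_add_single]
  push_cast
  exact sum_congr rfl fun l _ => by ring

lemma IsRapid.hasFDerivAt_HT {f : (Fin d → ℝ) → ℂ} (hf : IsRapid f) {c γ : Fin d → ℝ}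
    (hc : ∀ l, 0 < c l) (hγ : ∀ l, 0 ≤ γ l) {t : Fin d → ℝ} (ht : t ∈ Rpos d) :
    HasFDerivAt (HT c γ f) (∑ l, (-(c l : ℂ) * HT c (γ + Pi.single l 1) f t) • coordL l) t := by
  have hγ' : ∀ l m, 0 ≤ (γ + Pi.single l 1 : Fin d → ℝ) m := fun l m => by
    by_cases h : m = l
    · subst h; simpa using by linarith [hγ m]
    · simpa [h] using hγ m
  choose C hC0 hC using fun l => hf.hk_bound hc (hγ' l)
  have hR := ae_restrict_mem (μ := volume) (measurableSet_Rpos d)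
  have key := hasFDerivAt_integral_of_dominated_of_fderiv_le (𝕜 := ℝ)
    (μ := volume.restrict (Rpos d)) (F := fun t x => f x * (hk c γ x t : ℂ))
    (F' := fun t x => ∑ l, (-(c l : ℂ) * (f x * (hk c (γ + Pi.single l 1) x t : ℂ))) • coordL l)
    (bound := fun x => ∑ l, c l * (C l * cauchyProd x) * ‖coordL l‖)
    ((isOpen_Rpos d).mem_nhds ht) (.of_forall fun t => hf.aesm.mul (aesm_hk hγ t _))
    (hf.integrable_mul_hk hc hγ fun l => (ht l).le) ?_ ?_ ?_ ?_
  · refine key.congr_fderiv ?_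
    rw [integral_finsetSum]
    · refine sum_congr rfl fun l _ => ?_
      rw [integral_smul_const, integral_const_mul]; rfl
    · intro l _
      exact ((hf.integrable_mul_hk hc (hγ' l) fun l => (ht l).le).const_mul _).smul_const _
  · refine Finset.aestronglyMeasurable_fun_sum _ fun l _ => ?_
    exact (((hf.aesm.mul (aesm_hk (hγ' l) t _)).const_mul _)).smul_const _
  · refine hR.mono fun x hx s hs => ?_
    refine (norm_sum_le _ _).trans (sum_le_sum fun l _ => ?_)
    rw [norm_smul, norm_mul, norm_neg, Complex.norm_real, Real.norm_of_nonneg (hc l).le]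
    have := hc l
    gcongr
    exact hC l x hx s fun l => (hs l).le
  · refine integrable_finsetSum _ fun l _ => ?_
    exact ((integrable_cauchyProd.integrableOn.const_mul _).const_mul _).mul_const _
  · refine hR.mono fun x hx s _ => ?_
    refine ((hasFDerivAt_hk hγ hx s).const_mul (f x)).congr_fderiv ?_
    rw [smul_sum]
    refine sum_congr rfl fun l _ => ?_
    rw [smul_smul]
    congr 1
    ring

/-- Integrating a partial derivative over the orthant gives zero when the boundary terms vanish. -/
lemma integral_partial_eq_zero (l : Fin d) {G G' : (Fin d → ℝ) → ℂ}
    (hInt : IntegrableOn G' (Rpos d))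
    (hderiv : ∀ x ∈ Rpos d, HasDerivAt (fun s => G (Function.update x l s)) (G' x) (x l))
    (h0 : ∀ x ∈ Rpos d, Tendsto (fun s => G (Function.update x l s)) (nhdsWithin 0 (Set.Ioi 0))
      (nhds 0))
    (h1 : ∀ x ∈ Rpos d, Tendsto (fun s => G (Function.update x l s)) atTop (nhds 0)) :
    ∫ x in Rpos d, G' x = 0 := by
  obtain _ | n := d
  · exact l.elim0
  have hmp := (volume_preserving_piFinSuccAbove (fun _ : Fin (n + 1) => ℝ) l).symm
  set e := (MeasurableEquiv.piFinSuccAbove (fun _ : Fin (n + 1) => ℝ) l).symm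
  have he : ∀ p : ℝ × (Fin n → ℝ), e p = l.insertNth p.1 p.2 := fun _ => rfl
  have hpre : e ⁻¹' (Rpos (n + 1)) = Set.Ioi 0 ×ˢ Rpos n := by
    ext p
    simp [he, Rpos, Fin.forall_iff_succAbove l]
  rw [← hmp.setIntegral_preimage_emb e.measurableEmbedding]
  rw [← hmp.integrableOn_comp_preimage e.measurableEmbedding] at hInt
  rw [hpre] at hInt ⊢
  rw [Measure.volume_eq_prod, IntegrableOn, ← Measure.prod_restrict] at hInt
  rw [Measure.volume_eq_prod, ← Measure.prod_restrict, integral_prod_symm (fun p => G' (e p)) hInt]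
  refine integral_eq_zero_of_ae ?_
  filter_upwards [hInt.prod_left_ae, ae_restrict_mem (measurableSet_Rpos n)] with y hy hyR
  have hx : ∀ s : ℝ, 0 < s → (l.insertNth s y : Fin (n + 1) → ℝ) ∈ Rpos (n + 1) := by
    intro s hs
    simp only [Rpos, Set.mem_ofPred_eq, Fin.forall_iff_succAbove l]
    simpa using ⟨hs, hyR⟩
  have hup : ∀ s r : ℝ, Function.update (l.insertNth s y : Fin (n + 1) → ℝ) l r
      = l.insertNth r y := fun s r => by simp
  have h0' := h0 _ (hx 1 one_pos)
  have h1' := h1 _ (hx 1 one_pos)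
  have hd' : ∀ s ∈ Set.Ioi (0 : ℝ), HasDerivAt (fun s => G (l.insertNth s y))
      (G' (l.insertNth s y)) s := by
    intro s hs
    have := hderiv _ (hx s hs)
    simpa only [hup, Fin.insertNth_apply_same] using this
  simp only [hup] at h0' h1'
  have hInt' : IntegrableOn (fun s => G' (l.insertNth s y)) (Set.Ioi 0) := hy
  have := integral_Ioi_deriv_mul_eq_sub (u := fun s => G (l.insertNth s y)) (v := fun _ => 1)
    (u' := fun s => G' (l.insertNth s y)) (v' := fun _ => 0) hd'
    (fun s _ => hasDerivAt_const _ _) (a' := 0) (b' := 0) ?_ ?_ ?_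
  · simpa [he] using this
  · convert! hInt' using 1
    ext s; simp
  · convert! h0' using 1
    ext s; simp
  · convert! h1' using 1
    ext s; simp

lemma IsRapid.exists_bound_mul {f : (Fin d → ℝ) → ℂ} (hf : IsRapid f) {c γ : Fin d → ℝ}
    (hc : ∀ l, 0 < c l) (hγ : ∀ l, 0 ≤ γ l) (t : Fin d → ℝ) (ht : ∀ l, 0 ≤ t l) (l : Fin d) :
    ∃ C, ∀ x ∈ Rpos d, ‖(x l : ℂ) * (f x * (hk c γ x t : ℂ))‖ ≤ C * x l ∧
      ‖(x l : ℂ) * (f x * (hk c γ x t : ℂ))‖ ≤ C * (1 + x l ^ 2)⁻¹ := by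
  obtain ⟨C, hC0, hC⟩ := hf.hk_bound hc hγ
  obtain ⟨D, hD0, hD⟩ := (hf.coord_mul l).hk_bound hc hγ
  refine ⟨C + D, fun x hx => ⟨?_, ?_⟩⟩
  · rw [norm_mul, Complex.norm_real, Real.norm_of_nonneg (hx l).le, mul_comm]
    refine mul_le_mul_of_nonneg_right ((hC x hx t ht).trans ?_) (hx l).le
    nlinarith [cauchyProd_le_one x]
  · rw [← mul_assoc]
    refine (hD x hx t ht).trans ?_
    calc D * cauchyProd x ≤ D * (1 + x l ^ 2)⁻¹ :=
          mul_le_mul_of_nonneg_left (cauchyProd_le x l) hD0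
      _ ≤ (C + D) * (1 + x l ^ 2)⁻¹ := by gcongr; linarith

lemma update_mem_Rpos {x : Fin d → ℝ} (hx : x ∈ Rpos d) (l : Fin d) {s : ℝ} (hs : 0 < s) :
    Function.update x l s ∈ Rpos d := fun i => by
  by_cases h : i = l
  · subst h; simpa
  · simpa [h] using hx i

lemma hk_eq_erase (c γ x t : Fin d → ℝ) (l : Fin d) : hk c γ x t =
      (∏ j ∈ univ.erase l, (x j ^ γ j * kerR (γ j) (x j * (c j * t j)))) *
        (x l ^ γ l * kerR (γ l) (x l * (c l * t l))) :=
  (prod_erase_mul _ _ (mem_univ l)).symm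

/-- The kernel of order `γ + e_l`, stripped of the extra factor `x_l`. -/
def hkSucc (c γ x t : Fin d → ℝ) (l : Fin d) : ℝ :=
  (∏ j ∈ univ.erase l, (x j ^ γ j * kerR (γ j) (x j * (c j * t j)))) *
    (x l ^ γ l * kerR (γ l + 1) (x l * (c l * t l)))

lemma abs_hkSucc_le {c γ : Fin d → ℝ} (hc : ∀ l, 0 < c l) (hγ : ∀ l, 0 ≤ γ l) {x t : Fin d → ℝ}
    (hx : x ∈ Rpos d) (ht : ∀ l, 0 ≤ t l) (l : Fin d) :
    |hkSucc c γ x t l| ≤ kerBd (γ + Pi.single l 1) * ∏ l, x l ^ γ l := by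
  have hγ' : ∀ m, 0 ≤ (γ + Pi.single l 1 : Fin d → ℝ) m := fun m => by
    by_cases h : m = l
    · subst h; simpa using by linarith [hγ m]
    · simpa [h] using hγ m
  have h := abs_hk_le hc hγ' hx ht
  have e1 : hk c (γ + Pi.single l 1) x t = x l * hkSucc c γ x t l := by
    rw [hk_add_single, hkSucc, Real.rpow_add_one (hx l).ne']; ring
  have e2 : ∏ m, x m ^ (γ + Pi.single l 1 : Fin d → ℝ) m = x l * ∏ m, x m ^ γ m := by
    rw [← mul_prod_erase _ _ (mem_univ l), ← mul_prod_erase _ (fun m => x m ^ γ m) (mem_univ l)]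
    simp only [Pi.add_apply, Pi.single_eq_same]
    rw [Real.rpow_add_one (hx l).ne', mul_comm (x l ^ γ l), mul_assoc]
    congr 2
    refine prod_congr rfl fun m hm => ?_
    simp [ne_of_mem_erase hm]
  rw [e1, e2, abs_mul, abs_of_pos (hx l), mul_left_comm] at h
  exact le_of_mul_le_mul_left h (hx l)

lemma IsRapid.exists_bound_mul_succ {f : (Fin d → ℝ) → ℂ} (hf : IsRapid f) {c γ : Fin d → ℝ}
    (hc : ∀ l, 0 < c l) (hγ : ∀ l, 0 ≤ γ l) (t : Fin d → ℝ) (ht : ∀ l, 0 ≤ t l) (l : Fin d) :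
    ∃ C, ∀ x ∈ Rpos d, ‖(x l : ℂ) * (f x * (hkSucc c γ x t l : ℂ))‖ ≤ C * x l ∧
      ‖(x l : ℂ) * (f x * (hkSucc c γ x t l : ℂ))‖ ≤ C * (1 + x l ^ 2)⁻¹ := by
  obtain ⟨C, hC0, hC⟩ := hf.weight_bound hγ
  obtain ⟨D, hD0, hD⟩ := (hf.coord_mul l).weight_bound hγ
  set M := |kerBd (γ + Pi.single l 1)|
  have hM : 0 ≤ M := abs_nonneg _
  have key : ∀ x ∈ Rpos d, ∀ w : ℂ, ‖w * (hkSucc c γ x t l : ℂ)‖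
      ≤ M * ((∏ l, x l ^ γ l) * ‖w‖) := by
    intro x hx w
    have hp : 0 ≤ ∏ l, x l ^ γ l := prod_nonneg fun i _ => Real.rpow_nonneg (hx i).le _
    rw [norm_mul, Complex.norm_real, Real.norm_eq_abs]
    have := (abs_hkSucc_le hc hγ hx ht l).trans (mul_le_mul_of_nonneg_right (le_abs_self _) hp)
    calc _ ≤ ‖w‖ * (M * ∏ l, x l ^ γ l) := by gcongr
      _ = _ := by ring
  refine ⟨M * C + M * D, fun x hx => ⟨?_, ?_⟩⟩
  · rw [norm_mul, Complex.norm_real, Real.norm_of_nonneg (hx l).le, mul_comm]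
    refine mul_le_mul_of_nonneg_right ((key x hx _).trans ?_) (hx l).le
    have : M * ((∏ l, x l ^ γ l) * ‖f x‖) ≤ M * C := by
      refine mul_le_mul_of_nonneg_left ((hC x hx).trans ?_) hM
      nlinarith [cauchyProd_le_one x]
    nlinarith [mul_nonneg hM hD0]
  · rw [← mul_assoc]
    refine (key x hx _).trans ?_
    have h1 : M * ((∏ l, x l ^ γ l) * ‖(x l : ℂ) * f x‖) ≤ M * D * (1 + x l ^ 2)⁻¹ := by
      rw [mul_assoc]
      exact mul_le_mul_of_nonneg_left ((hD x hx).trans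
        (mul_le_mul_of_nonneg_left (cauchyProd_le x l) hD0)) hM
    have h2 : 0 ≤ M * C * (1 + x l ^ 2)⁻¹ := by positivity
    linarith

lemma SmoothPos.hasDerivAt_comp_update {f : (Fin d → ℝ) → ℂ} (hf : SmoothPos f) {x : Fin d → ℝ}
    (hx : x ∈ Rpos d) (l : Fin d) :
    HasDerivAt (fun s => f (Function.update x l s)) (_root_.pd l f x) (x l) := by
  have h1 := hasDerivAt_update x l (x l)
  have h2 : HasFDerivAt f (fderiv ℝ f x) (Function.update x l (x l)) := by
    rw [Function.update_eq_self]; exact (hf.differentiableAt hx).hasFDerivAt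
  exact h2.comp_hasDerivAt _ h1

/-- The Bessel-type differential operator `x_l ∂_l² + (γ_l + 1) ∂_l`. -/
def besselOp (γ : ℝ) (l : Fin d) (f : (Fin d → ℝ) → ℂ) : (Fin d → ℝ) → ℂ :=
  (fun x => (x l : ℂ) * pd l (pd l f) x) + fun x => ((γ + 1 : ℝ) : ℂ) * pd l f x

lemma IsRapid.besselOp {f : (Fin d → ℝ) → ℂ} (hf : IsRapid f) (γ : ℝ) (l : Fin d) :
    IsRapid (besselOp γ l f) :=
  (((hf.pd l).pd l).coord_mul l).add ((hf.pd l).const_mul _)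

lemma tendsto_inv_one_add_sq : Tendsto (fun s : ℝ => (1 + s ^ 2)⁻¹) atTop (nhds 0) :=
  tendsto_inv_atTop_zero.comp
    (tendsto_atTop_add_const_left _ _ (tendsto_pow_atTop (by norm_num)))

lemma IsRapid.HT_besselOp {f : (Fin d → ℝ) → ℂ} (hf : IsRapid f) {c γ : Fin d → ℝ}
    (hc : ∀ l, 0 < c l) (hγ : ∀ l, 0 ≤ γ l) {t : Fin d → ℝ} (ht : ∀ l, 0 ≤ t l) (l : Fin d) :
    HT c γ (_root_.besselOp (γ l) l f) t + (c l * t l : ℝ) * HT c γ f t = 0 := by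
  set τ := c l * t l with hτ
  set G : (Fin d → ℝ) → ℂ := fun x => (x l : ℂ) * (_root_.pd l f x * (hk c γ x t : ℂ)) +
    (τ : ℂ) * ((x l : ℂ) * (f x * (hkSucc c γ x t l : ℂ)))
  obtain ⟨C, hC⟩ := (hf.pd l).exists_bound_mul hc hγ t ht l
  obtain ⟨D, hD⟩ := hf.exists_bound_mul_succ hc hγ t ht l
  have i1 := (hf.besselOp (γ l) l).integrable_mul_hk hc hγ ht
  have i2 := (hf.integrable_mul_hk hc hγ ht).const_mul (τ : ℂ)
  have hG : ∀ x ∈ Rpos d, ‖G x‖ ≤ (C + ‖(τ : ℂ)‖ * D) * x l ∧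
      ‖G x‖ ≤ (C + ‖(τ : ℂ)‖ * D) * (1 + x l ^ 2)⁻¹ := by
    intro x hx
    have h := norm_add_le ((x l : ℂ) * (_root_.pd l f x * (hk c γ x t : ℂ)))
      ((τ : ℂ) * ((x l : ℂ) * (f x * (hkSucc c γ x t l : ℂ))))
    rw [norm_mul (τ : ℂ)] at h
    have h1 := mul_le_mul_of_nonneg_left (hD x hx).1 (norm_nonneg (τ : ℂ))
    have h2 := mul_le_mul_of_nonneg_left (hD x hx).2 (norm_nonneg (τ : ℂ))
    constructor
    · refine h.trans ?_; linarith [(hC x hx).1]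
    · refine h.trans ?_; linarith [(hC x hx).2]
  have key := integral_partial_eq_zero l (G := G) (G' := fun x =>
    _root_.besselOp (γ l) l f x * (hk c γ x t : ℂ) + (τ : ℂ) * (f x * (hk c γ x t : ℂ)))
    (i1.add i2) ?_ ?_ ?_
  · rw [integral_add i1 i2, integral_const_mul] at key
    exact key
  · intro x hx
    obtain ⟨R, hRdef⟩ : ∃ R : ℝ, R = ∏ j ∈ univ.erase l,
        (x j ^ γ j * kerR (γ j) (x j * (c j * t j))) := ⟨_, rfl⟩
    have hR : ∀ s : ℝ, ∏ j ∈ univ.erase l, (Function.update x l s j ^ γ j *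
        kerR (γ j) (Function.update x l s j * (c j * t j))) = R := fun s =>
      hRdef ▸ prod_congr rfl fun j hj => by rw [Function.update_of_ne (ne_of_mem_erase hj)]
    have hs0 := hx l
    have hk1 : ∀ γ' : ℝ, 0 ≤ γ' → HasDerivAt (fun s : ℝ => (kerR γ' (s * τ) : ℂ))
        ((-kerR (γ' + 1) (x l * τ) * τ : ℝ) : ℂ) (x l) := fun γ' h => by
      have := ((hasDerivAt_kerR h (x l * τ)).comp (x l)
        ((hasDerivAt_id (x l)).mul_const τ)).ofReal_comp
      simpa using this
    have hp : HasDerivAt (fun s : ℝ => ((s * s ^ γ l : ℝ) : ℂ))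
        (((γ l + 1) * x l ^ γ l : ℝ) : ℂ) (x l) := by
      have := ((hasDerivAt_id (x l)).mul
        (Real.hasDerivAt_rpow_const (p := γ l) (Or.inl hs0.ne'))).ofReal_comp
      refine this.congr_deriv ?_
      congr 1
      have : x l ^ γ l = x l ^ (γ l - 1) * x l := by
        rw [← Real.rpow_add_one hs0.ne']; congr 1; ring
      simp only [id, this]; ring
    have hmain := (hp.mul (((hf.pd l).smooth.hasDerivAt_comp_update hx l).mul (hk1 (γ l) (hγ l)) |>.add
      (((hf.smooth.hasDerivAt_comp_update hx l).mul (hk1 (γ l + 1) (by linarith [hγ l]))).const_mul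
        (τ : ℂ)))).const_mul (R : ℂ)
    refine (hmain.congr_of_eventuallyEq (.of_forall fun s => ?_)).congr_deriv ?_
    · simp only [G, hk_eq_erase c γ _ t l, hkSucc, hR, Function.update_self, ← hτ, Pi.mul_apply,
        Pi.add_apply]
      push_cast
      ring
    · simp only [hk_eq_erase c γ x t l, Function.update_eq_self, ← hτ, Pi.mul_apply,
        Pi.add_apply, _root_.besselOp]
      have hrec := kerR_recurrence (hγ l) (x l * τ)
      have e : γ l + 1 + 1 = γ l + 2 := by ring
      rw [e, ← hRdef, hrec]
      push_cast
      ring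
  · intro x hx
    have hb : ∀ᶠ s in nhdsWithin (0 : ℝ) (Set.Ioi 0), ‖G (Function.update x l s)‖
        ≤ (C + ‖(τ : ℂ)‖ * D) * s := by
      filter_upwards [self_mem_nhdsWithin] with s hs
      simpa using (hG _ (update_mem_Rpos hx l hs)).1
    refine squeeze_zero_norm' hb ?_
    have : Tendsto (fun s : ℝ => (C + ‖(τ : ℂ)‖ * D) * s) (nhds 0) (nhds ((C + ‖(τ : ℂ)‖ * D) * 0)) :=
      tendsto_id.const_mul _
    rw [mul_zero] at this
    exact this.mono_left nhdsWithin_le_nhds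
  · intro x hx
    have hb : ∀ᶠ s in (atTop : Filter ℝ), ‖G (Function.update x l s)‖
        ≤ (C + ‖(τ : ℂ)‖ * D) * (1 + s ^ 2)⁻¹ := by
      filter_upwards [eventually_gt_atTop 0] with s hs
      simpa using (hG _ (update_mem_Rpos hx l hs)).2
    refine squeeze_zero_norm' hb ?_
    simpa using tendsto_inv_one_add_sq.const_mul (C + ‖(τ : ℂ)‖ * D)

lemma add_single_nonneg {γ : Fin d → ℝ} (hγ : ∀ l, 0 ≤ γ l) (l : Fin d) :
    ∀ m, 0 ≤ (γ + Pi.single l 1 : Fin d → ℝ) m := fun m => by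
  by_cases h : m = l
  · subst h; simpa using by linarith [hγ m]
  · simpa [h] using hγ m

lemma IsRapid.contDiffOn_HT {f : (Fin d → ℝ) → ℂ} (hf : IsRapid f) {c : Fin d → ℝ}
    (hc : ∀ l, 0 < c l) (n : ℕ) : ∀ {γ : Fin d → ℝ}, (∀ l, 0 ≤ γ l) →
    ContDiffOn ℝ n (HT c γ f) (Rpos d) := by
  induction n with
  | zero =>
    intro γ hγ
    exact contDiffOn_zero.2 ((hf.continuousOn_HT hc hγ).mono fun t ht l => (ht l).le)
  | succ n ih =>
    intro γ hγ
    rw [Nat.cast_add, Nat.cast_one, contDiffOn_succ_iff_fderiv_of_isOpen (isOpen_Rpos d)]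
    refine ⟨fun t ht => (hf.hasFDerivAt_HT hc hγ ht).differentiableAt.differentiableWithinAt,
      by simp, ?_⟩
    refine ContDiffOn.congr ?_ fun t ht => (hf.hasFDerivAt_HT hc hγ ht).fderiv
    exact ContDiffOn.sum fun l _ =>
      (contDiffOn_const.mul (ih (add_single_nonneg hγ l))).smul contDiffOn_const

lemma IsRapid.smooth_HT {f : (Fin d → ℝ) → ℂ} (hf : IsRapid f) {c γ : Fin d → ℝ}
    (hc : ∀ l, 0 < c l) (hγ : ∀ l, 0 ≤ γ l) : SmoothPos (HT c γ f) :=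
  contDiffOn_infty.2 fun n => hf.contDiffOn_HT hc n hγ

lemma IsRapid.pd_HT {f : (Fin d → ℝ) → ℂ} (hf : IsRapid f) {c γ : Fin d → ℝ}
    (hc : ∀ l, 0 < c l) (hγ : ∀ l, 0 ≤ γ l) (l : Fin d) :
    Set.EqOn (_root_.pd l (HT c γ f)) (fun t => -(c l : ℂ) * HT c (γ + Pi.single l 1) f t)
      (Rpos d) := fun t ht => by
  unfold _root_.pd
  rw [(hf.hasFDerivAt_HT hc hγ ht).fderiv]
  simp only [_root_.sum_apply, _root_.smul_apply, coordL_apply]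
  rw [sum_eq_single l]
  · simp
  · intro b _ hb; simp [hb]
  · simp

/-- `h` agrees on the orthant with a multiple of some Hankel–Clifford transform of `f`. -/
def IsHTMultiple (c : Fin d → ℝ) (f h : (Fin d → ℝ) → ℂ) : Prop :=
  ∃ (a : ℂ) (γ : Fin d → ℝ), (∀ l, 0 ≤ γ l) ∧ Set.EqOn h (fun t => a * HT c γ f t) (Rpos d)

lemma IsHTMultiple.pd {f h : (Fin d → ℝ) → ℂ} (hf : IsRapid f) {c : Fin d → ℝ}
    (hc : ∀ l, 0 < c l) (hh : IsHTMultiple c f h) (l : Fin d) : IsHTMultiple c f (pd l h) := by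
  obtain ⟨a, γ, hγ, e⟩ := hh
  refine ⟨a * -(c l : ℂ), γ + Pi.single l 1, add_single_nonneg hγ l, fun t ht => ?_⟩
  rw [pd_congr e l ht, pd_const_mul (hf.smooth_HT hc hγ) a l ht]
  simp only [hf.pd_HT hc hγ l ht, mul_assoc]

lemma IsHTMultiple.pdl {f : (Fin d → ℝ) → ℂ} (hf : IsRapid f) {c : Fin d → ℝ}
    (hc : ∀ l, 0 < c l) (L : List (Fin d)) : ∀ {h : (Fin d → ℝ) → ℂ}, IsHTMultiple c f h →
      IsHTMultiple c f (pdl L h) := by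
  induction L with
  | nil => exact fun h => h
  | cons m L ih => exact fun h => ih (h.pd hf hc m)

lemma mderiv_eq_pdl (p : Fin d → ℕ) (f : (Fin d → ℝ) → ℂ) : ∃ L, mderiv p f = pdl L f := by
  refine ⟨((List.finRange d).map fun i => List.replicate (p i) i).reverse.flatten, ?_⟩
  rw [← foldr_comp_pd p (List.finRange d)]
  simp [mderiv, List.ofFn_eq_map]

lemma IsRapid.coord_mul_HT {f : (Fin d → ℝ) → ℂ} (hf : IsRapid f) {c γ : Fin d → ℝ}
    (hc : ∀ l, 0 < c l) (hγ : ∀ l, 0 ≤ γ l) (l : Fin d) :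
    ∃ g, IsRapid g ∧ ∀ t ∈ Rpos d, (t l : ℂ) * HT c γ f t = HT c γ g t := by
  refine ⟨fun x => -(c l : ℂ)⁻¹ * _root_.besselOp (γ l) l f x,
    (hf.besselOp (γ l) l).const_mul _, fun t ht => ?_⟩
  have h := hf.HT_besselOp hc hγ (fun l => (ht l).le) l
  have e : HT c γ (fun x => -(c l : ℂ)⁻¹ * _root_.besselOp (γ l) l f x) t
      = -(c l : ℂ)⁻¹ * HT c γ (_root_.besselOp (γ l) l f) t := by
    simp only [HT, mul_assoc]
    exact integral_const_mul _ _
  have hc' : (c l : ℂ) ≠ 0 := by exact_mod_cast (hc l).ne'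
  rw [e, eq_neg_of_add_eq_zero_left h]
  push_cast
  field_simp

lemma IsRapid.prod_pow_mul_HT {f : (Fin d → ℝ) → ℂ} (hf : IsRapid f) {c γ : Fin d → ℝ}
    (hc : ∀ l, 0 < c l) (hγ : ∀ l, 0 ≤ γ l) (k : Fin d → ℕ) (s : Finset (Fin d)) :
    ∃ g, IsRapid g ∧ ∀ t ∈ Rpos d, (∏ i ∈ s, (t i : ℂ) ^ k i) * HT c γ f t = HT c γ g t := by
  induction s using Finset.induction_on with
  | empty => exact ⟨f, hf, by simp⟩
  | insert l s hl ih =>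
    obtain ⟨g, hg, e⟩ := ih
    have : ∀ n : ℕ, ∃ g', IsRapid g' ∧ ∀ t ∈ Rpos d, (t l : ℂ) ^ n * HT c γ g t = HT c γ g' t := by
      intro n
      induction n with
      | zero => exact ⟨g, hg, by simp⟩
      | succ n ihn =>
        obtain ⟨g', hg', e'⟩ := ihn
        obtain ⟨g'', hg'', e''⟩ := hg'.coord_mul_HT hc hγ l
        exact ⟨g'', hg'', fun t ht => by rw [pow_succ', mul_assoc, e' t ht, e'' t ht]⟩
    obtain ⟨g', hg', e'⟩ := this (k l)
    exact ⟨g', hg', fun t ht => by rw [prod_insert hl, mul_assoc, e t ht, e' t ht]⟩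

lemma IsRapid.isSPlus_HT {f : (Fin d → ℝ) → ℂ} (hf : IsRapid f) {c γ : Fin d → ℝ}
    (hc : ∀ l, 0 < c l) (hγ : ∀ l, 0 ≤ γ l) (a : ℂ) : IsSPlus fun t => a * HT c γ f t := by
  have key : ∀ p, IsHTMultiple c f (mderiv p fun t => a * HT c γ f t) := fun p => by
    obtain ⟨L, hL⟩ := mderiv_eq_pdl p fun t => a * HT c γ f t
    rw [hL]
    exact IsHTMultiple.pdl hf hc L ⟨a, γ, hγ, fun _ _ => rfl⟩
  refine ⟨contDiffOn_const.mul (hf.smooth_HT hc hγ), fun p => ?_, fun k p => ?_⟩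
  · obtain ⟨b, γ', hγ', e⟩ := key p
    exact ⟨_, continuousOn_const.mul (hf.continuousOn_HT hc hγ'), fun x hx => (e hx).symm⟩
  · obtain ⟨b, γ', hγ', e⟩ := key p
    obtain ⟨g, hg, e'⟩ := hf.prod_pow_mul_HT hc hγ' k univ
    obtain ⟨C, hC⟩ := hg.norm_HT_le hc hγ'
    refine ⟨‖b‖ * C, fun x hx => ?_⟩
    have h : (∏ i, x i ^ k i) = ‖∏ i, (x i : ℂ) ^ k i‖ := by
      simp only [norm_prod, norm_pow, Complex.norm_real]
      exact prod_congr rfl fun i _ => by rw [Real.norm_of_nonneg (hx i).le]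
    rw [e hx, h, norm_mul, mul_left_comm, ← norm_mul, e' x hx]
    exact mul_le_mul_of_nonneg_left (hC x fun l => (hx l).le) (norm_nonneg _)

lemma IsRapid.HT {f : (Fin d → ℝ) → ℂ} (hf : IsRapid f) {c γ : Fin d → ℝ}
    (hc : ∀ l, 0 < c l) (hγ : ∀ l, 0 ≤ γ l) : IsRapid (HT c γ f) := by
  simpa using (hf.isSPlus_HT hc hγ 1).isRapid

lemma integral_Rpos_prod {d : ℕ} (h : Fin d → ℝ → ℝ) :
    ∫ x in Rpos d, ∏ l, h l (x l) = ∏ l, ∫ s in Set.Ioi (0 : ℝ), h l s := by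
  have e : Rpos d = Set.pi Set.univ fun _ => Set.Ioi 0 := by ext x; simp [Rpos]
  rw [e, volume_pi, Measure.restrict_pi_pi]
  exact integral_fintype_prod_eq_prod (𝕜 := ℝ) h

/-- The product exponential `x ↦ exp(-∑ a_l x_l)`. -/
def expProd {d : ℕ} (a x : Fin d → ℝ) : ℝ := ∏ l, Real.exp (-(a l * x l))

lemma integral_expProd_mul_hk {d : ℕ} {a c γ : Fin d → ℝ} (ha : ∀ l, 0 < a l)
    (hγ : ∀ l, 0 ≤ γ l) (t : Fin d → ℝ) :
    ∫ x in Rpos d, expProd a x * hk c γ x t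
      = (∏ l, a l ^ (-1 - γ l)) * expProd (fun l => c l / a l) t := by
  simp only [expProd, hk, ← prod_mul_distrib]
  rw [integral_Rpos_prod fun l s => Real.exp (-(a l * s)) * (s ^ γ l * kerR (γ l) (s * (c l * t l)))]
  refine prod_congr rfl fun l _ => ?_
  rw [integral_exp_mul_kerR (hγ l) (ha l)]
  congr 3
  ring

lemma HT_expProd {d : ℕ} {a c γ : Fin d → ℝ} (ha : ∀ l, 0 < a l)
    (hγ : ∀ l, 0 ≤ γ l) (t : Fin d → ℝ) :
    HT c γ (fun x => (expProd a x : ℂ)) t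
      = ((∏ l, a l ^ (-1 - γ l) : ℝ) : ℂ) * (expProd (fun l => c l / a l) t : ℂ) := by
  rw [← Complex.ofReal_mul, ← integral_expProd_mul_hk ha hγ, ← integral_complex_ofReal]
  simp [HT]

lemma HT_const_mul {d : ℕ} (c γ : Fin d → ℝ) (a : ℂ) (f : (Fin d → ℝ) → ℂ) (t : Fin d → ℝ) :
    HT c γ (fun x => a * f x) t = a * HT c γ f t := by
  simp only [HT, mul_assoc]
  exact integral_const_mul _ _

lemma HT_HT_expProd {d : ℕ} {a c γ : Fin d → ℝ} (ha : ∀ l, 0 < a l) (hc : ∀ l, 0 < c l)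
    (hγ : ∀ l, 0 ≤ γ l) (t : Fin d → ℝ) :
    HT c γ (HT c γ fun x => (expProd a x : ℂ)) t
      = ((∏ l, c l ^ (-1 - γ l) : ℝ) : ℂ) * (expProd a t : ℂ) := by
  have e : HT c γ (fun x => (expProd a x : ℂ)) = fun t => ((∏ l, a l ^ (-1 - γ l) : ℝ) : ℂ) *
      (expProd (fun l => c l / a l) t : ℂ) := funext (HT_expProd ha hγ)
  have h1 : (∏ l, a l ^ (-1 - γ l)) * ∏ l, (c l / a l) ^ (-1 - γ l)
      = ∏ l, c l ^ (-1 - γ l) := by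
    rw [← prod_mul_distrib]
    refine prod_congr rfl fun l _ => ?_
    rw [← Real.mul_rpow (ha l).le (div_pos (hc l) (ha l)).le, mul_div_cancel₀ _ (ha l).ne']
  have h2 : (fun l => c l / (c l / a l)) = a := by
    ext l
    have := (ha l).ne'
    have := (hc l).ne'
    field_simp
  rw [e, HT_const_mul, HT_expProd (fun l => div_pos (hc l) (ha l)) hγ, ← mul_assoc,
    ← Complex.ofReal_mul, h1, h2]

lemma expProd_integrable_weight {d : ℕ} {a γ : Fin d → ℝ} (ha : ∀ l, 0 < a l)
    (hγ : ∀ l, 0 ≤ γ l) :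
    IntegrableOn (fun x => expProd a x * ∏ l, x l ^ γ l) (Rpos d) := by
  have e : Rpos d = Set.pi Set.univ fun _ => Set.Ioi 0 := by ext x; simp [Rpos]
  simp only [expProd, ← prod_mul_distrib]
  rw [IntegrableOn, e, volume_pi, Measure.restrict_pi_pi]
  refine Integrable.fintype_prod (f := fun l s => Real.exp (-(a l * s)) * s ^ γ l) fun l => ?_
  have := integrableOn_rpow_mul_exp_neg_mul_rpow (p := 1) (s := γ l) (b := a l)
    (by linarith [hγ l]) one_pos (ha l)
  refine this.congr_fun (fun s _ => ?_) measurableSet_Ioi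
  simp [mul_comm]

/-- The Hankel–Clifford transform is symmetric for the bilinear pairing with weight `t^γ`. -/
lemma HT_symm {d : ℕ} {c γ : Fin d → ℝ} (hc : ∀ l, 0 < c l) (hγ : ∀ l, 0 ≤ γ l)
    {f g : (Fin d → ℝ) → ℂ}
    (hf : IntegrableOn (fun x => f x * ((∏ l, x l ^ γ l : ℝ) : ℂ)) (Rpos d))
    (hg : IntegrableOn (fun x => g x * ((∏ l, x l ^ γ l : ℝ) : ℂ)) (Rpos d)) :
    ∫ t in Rpos d, HT c γ f t * (g t * ((∏ l, t l ^ γ l : ℝ) : ℂ))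
      = ∫ x in Rpos d, HT c γ g x * (f x * ((∏ l, x l ^ γ l : ℝ) : ℂ)) := by
  set μ := (volume : Measure (Fin d → ℝ)).restrict (Rpos d)
  set q : (Fin d → ℝ) → (Fin d → ℝ) → ℝ := fun x t => ∏ l, kerR (γ l) (x l * (c l * t l))
  have hqc : Continuous fun p : (Fin d → ℝ) × (Fin d → ℝ) => q p.1 p.2 :=
    continuous_finsetProd _ fun l _ => (continuous_kerR (hγ l)).comp (by fun_prop)
  have hq : ∀ x t, hk c γ x t = (∏ l, x l ^ γ l) * q x t := fun x t => prod_mul_distrib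
  have hqs : ∀ x t, q x t = q t x := fun x t =>
    prod_congr rfl fun l _ => by rw [show x l * (c l * t l) = t l * (c l * x l) by ring]
  have hqb : ∀ x ∈ Rpos d, ∀ t ∈ Rpos d, |q x t| ≤ kerBd γ := fun x hx t ht => by
    simp only [q, kerBd, abs_prod]
    refine prod_le_prod (fun _ _ => abs_nonneg _) fun l _ => ?_
    exact abs_kerR_le (hγ l) (mul_pos (hx l) (mul_pos (hc l) (ht l))).le
  set F := fun x => f x * ((∏ l, x l ^ γ l : ℝ) : ℂ)
  set H := fun x => g x * ((∏ l, x l ^ γ l : ℝ) : ℂ)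
  have e : ∀ (u : (Fin d → ℝ) → ℂ) t, HT c γ u t
      = ∫ x, (u x * ((∏ l, x l ^ γ l : ℝ) : ℂ)) * (q x t : ℂ) ∂μ := fun u t => by
    simp only [HT, hq, Complex.ofReal_mul, mul_assoc]
    rfl
  have hInt : Integrable (fun p : (Fin d → ℝ) × (Fin d → ℝ) => (F p.2 * (q p.2 p.1 : ℂ)) * H p.1)
      (μ.prod μ) := by
    have h1 := (hg.mul_prod hf).norm.const_mul (kerBd γ)
    refine Integrable.mono' h1 ?_ ?_
    · have a1 := (hg.mul_prod hf).aestronglyMeasurable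
      have a2 : AEStronglyMeasurable (fun p : (Fin d → ℝ) × (Fin d → ℝ) => (q p.2 p.1 : ℂ))
          (μ.prod μ) :=
        (Complex.continuous_ofReal.comp (hqc.comp continuous_swap)).aestronglyMeasurable
      refine (a1.mul a2).congr (.of_forall fun p => ?_)
      simp only [F, H, Pi.mul_apply]
      ring
    · have : ∀ᵐ p ∂(μ.prod μ), p ∈ Rpos d ×ˢ Rpos d := by
        rw [Measure.prod_restrict]
        exact ae_restrict_mem ((measurableSet_Rpos d).prod (measurableSet_Rpos d))
      filter_upwards [this] with p hp
      have hb : ‖(q p.2 p.1 : ℂ)‖ ≤ kerBd γ := by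
        rw [Complex.norm_real]; exact hqb p.2 hp.2 p.1 hp.1
      calc ‖F p.2 * (q p.2 p.1 : ℂ) * H p.1‖ = ‖F p.2‖ * ‖(q p.2 p.1 : ℂ)‖ * ‖H p.1‖ := by
            rw [norm_mul, norm_mul (F p.2)]
        _ ≤ ‖F p.2‖ * kerBd γ * ‖H p.1‖ := by gcongr
        _ = kerBd γ * ‖H p.1 * F p.2‖ := by rw [norm_mul (H p.1)]; ring
  calc ∫ t, HT c γ f t * H t ∂μ = ∫ t, ∫ x, (F x * (q x t : ℂ)) * H t ∂μ ∂μ := by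
        refine integral_congr_ae (.of_forall fun t => ?_)
        simp only [e f t]
        rw [← integral_mul_const]
    _ = ∫ x, ∫ t, (F x * (q x t : ℂ)) * H t ∂μ ∂μ := integral_integral_swap hInt
    _ = ∫ x, HT c γ g x * F x ∂μ := by
        refine integral_congr_ae (.of_forall fun x => ?_)
        simp only [e g x]
        rw [← integral_mul_const]
        refine integral_congr_ae (.of_forall fun t => ?_)
        simp only [H, hqs x t]
        ring

/-- A bounded strictly decreasing continuous function equal to `exp (-s)` for `s ≥ 0`. -/
def expTrunc (s : ℝ) : ℝ := Real.exp (-max s 0) + (1 - Real.exp (min s 0))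

lemma expTrunc_of_nonneg {s : ℝ} (hs : 0 ≤ s) : expTrunc s = Real.exp (-s) := by
  simp [expTrunc, hs]

lemma expTrunc_injective : Function.Injective expTrunc := by
  intro s r h
  wlog hsr : s ≤ r generalizing s r
  · exact (this h.symm (le_of_not_ge hsr)).symm
  have h1 : Real.exp (-max r 0) ≤ Real.exp (-max s 0) :=
    Real.exp_le_exp.2 (neg_le_neg (max_le_max_right 0 hsr))
  have h2 : Real.exp (min s 0) ≤ Real.exp (min r 0) :=
    Real.exp_le_exp.2 (min_le_min_right 0 hsr)
  unfold expTrunc at h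
  have e1 : max s 0 = max r 0 := neg_injective (Real.exp_injective (by linarith))
  have e2 : min s 0 = min r 0 := Real.exp_injective (by linarith)
  linarith [max_add_min s 0, max_add_min r 0]

lemma abs_expTrunc_le (s : ℝ) : |expTrunc s| ≤ 2 := by
  have h1 : Real.exp (-max s 0) ≤ 1 := Real.exp_le_one_iff.2 (by simp)
  have h2 : Real.exp (min s 0) ≤ 1 := Real.exp_le_one_iff.2 (by simp)
  have h3 := Real.exp_pos (-max s 0)
  have h4 := Real.exp_pos (min s 0)
  unfold expTrunc
  rw [abs_le]; constructor <;> linarith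

/-- `x ↦ expTrunc (x l)` as a bounded continuous function. -/
def expTruncBCF {d : ℕ} (l : Fin d) : BoundedContinuousFunction (Fin d → ℝ) ℝ :=
  .ofNormedAddCommGroup (fun x => expTrunc (x l)) (by unfold expTrunc; fun_prop) 2
    fun x => abs_expTrunc_le _

lemma aeval_expTruncBCF_apply {d : ℕ} (p : MvPolynomial (Fin d) ℝ) (x : Fin d → ℝ) :
    MvPolynomial.aeval (expTruncBCF (d := d)) p x
      = MvPolynomial.eval (fun l => expTrunc (x l)) p := by
  induction p using MvPolynomial.induction_on with
  | C a => simp [BoundedContinuousFunction.algebraMap_apply]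
  | add p q hp hq => simp [hp, hq]
  | mul_X p l hp => simp [hp, expTruncBCF]

/-- A function on the orthant with vanishing Laplace transform at integer points vanishes. -/
lemma ae_eq_zero_of_integral_mul_exp_eq_zero {d : ℕ} {G : (Fin d → ℝ) → ℝ}
    (hG : IntegrableOn G (Rpos d))
    (h : ∀ n : Fin d → ℕ, ∫ x in Rpos d, (∏ l, Real.exp (-x l) ^ n l) * G x = 0) :
    G =ᵐ[volume.restrict (Rpos d)] 0 := by
  set μ := (volume : Measure (Fin d → ℝ)).restrict (Rpos d)
  have hG : Integrable G μ := hG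
  have hm : AEMeasurable (fun x => ENNReal.ofReal (G x)) μ := hG.aemeasurable.ennreal_ofReal
  have hm' : AEMeasurable (fun x => ENNReal.ofReal (-G x)) μ := hG.neg.aemeasurable.ennreal_ofReal
  set P := μ.withDensity fun x => ENNReal.ofReal (G x)
  set P' := μ.withDensity fun x => ENNReal.ofReal (-G x)
  have : IsFiniteMeasure P := isFiniteMeasure_withDensity_ofReal hG.2
  have : IsFiniteMeasure P' := isFiniteMeasure_withDensity_ofReal hG.neg.2
  have hInt : ∀ g : BoundedContinuousFunction (Fin d → ℝ) ℝ, ∀ {u : (Fin d → ℝ) → ℝ},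
      Integrable u μ → Integrable (fun x => g x * u x) μ := fun g u hu =>
    hu.bdd_mul g.continuous.aestronglyMeasurable (.of_forall g.norm_coe_le_norm)
  have hdiff : ∀ g : BoundedContinuousFunction (Fin d → ℝ) ℝ,
      ∫ x, g x * G x ∂μ = 0 → ∫ x, g x ∂P = ∫ x, g x ∂P' := by
    intro g hg
    rw [integral_withDensity_eq_integral_toReal_smul₀ hm (by simp),
      integral_withDensity_eq_integral_toReal_smul₀ hm' (by simp), ← sub_eq_zero,
      ← integral_sub, ← hg]
    · refine integral_congr_ae (.of_forall fun x => ?_)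
      simp only [ENNReal.toReal_ofReal', smul_eq_mul]
      rcases le_total (G x) 0 with h | h
      · rw [max_eq_right h, max_eq_left (by linarith)]; ring
      · rw [max_eq_left h, max_eq_right (by linarith)]; ring
    · simpa only [ENNReal.toReal_ofReal', smul_eq_mul, mul_comm] using hInt g hG.pos_part
    · simpa only [ENNReal.toReal_ofReal', smul_eq_mul, mul_comm] using hInt g hG.neg_part
  have hpoly : ∀ p : MvPolynomial (Fin d) ℝ,
      ∫ x, MvPolynomial.aeval (expTruncBCF (d := d)) p x * G x ∂μ = 0 := by
    intro p
    induction p using MvPolynomial.induction_on' with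
    | monomial n a =>
      rw [← mul_zero a, ← h n, ← integral_const_mul]
      refine setIntegral_congr_fun (measurableSet_Rpos d) fun x hx => ?_
      simp only [aeval_expTruncBCF_apply, MvPolynomial.eval_monomial]
      rw [Finsupp.prod_fintype _ _ (by simp), mul_assoc]
      simp only [expTrunc_of_nonneg (hx _).le]
    | add p q hp hq =>
      simp only [map_add, BoundedContinuousFunction.add_apply, add_mul]
      rw [integral_add (hInt _ hG) (hInt _ hG), hp, hq, add_zero]
  let A : StarSubalgebra ℝ (BoundedContinuousFunction (Fin d → ℝ) ℝ) :=
    { (MvPolynomial.aeval (expTruncBCF (d := d))).range with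
      star_mem' := fun {a} ha => by
        have : star a = a := by ext x; simp
        rw [this]; exact ha }
  have hPP : P = P' := by
    refine ext_of_forall_mem_subalgebra_integral_eq_of_polish (𝕜 := ℝ) (A := A) ?_ ?_
    · intro x y hxy
      obtain ⟨l, hl⟩ := Function.ne_iff.1 hxy
      refine ⟨expTruncBCF l, ⟨_, ⟨expTruncBCF l, ⟨MvPolynomial.X l, by simp⟩, rfl⟩, rfl⟩, ?_⟩
      exact fun he => hl (expTrunc_injective he)
    · rintro g ⟨p, rfl⟩
      exact hdiff _ (hpoly p)
  have hfin : ∫⁻ x, ENNReal.ofReal (G x) ∂μ ≠ ⊤ :=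
    hG.lintegral_lt_top.ne
  filter_upwards [(withDensity_eq_iff hm hm' hfin).1 hPP] with x hx
  rcases lt_trichotomy (G x) 0 with hlt | h0 | hgt
  · rw [ENNReal.ofReal_of_nonpos hlt.le, eq_comm, ENNReal.ofReal_eq_zero] at hx; linarith
  · exact h0
  · rw [ENNReal.ofReal_of_nonpos (by linarith : -G x ≤ 0), ENNReal.ofReal_eq_zero] at hx; linarith

lemma ae_eq_zero_of_integral_mul_exp_eq_zero_complex {d : ℕ} {G : (Fin d → ℝ) → ℂ}
    (hG : IntegrableOn G (Rpos d))
    (h : ∀ n : Fin d → ℕ, ∫ x in Rpos d, ((∏ l, Real.exp (-x l) ^ n l : ℝ) : ℂ) * G x = 0) :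
    G =ᵐ[volume.restrict (Rpos d)] 0 := by
  have hInt : ∀ n : Fin d → ℕ,
      IntegrableOn (fun x => ((∏ l, Real.exp (-x l) ^ n l : ℝ) : ℂ) * G x) (Rpos d) := by
    intro n
    refine Integrable.bdd_mul (c := 1) hG ?_ ?_
    · exact Continuous.aestronglyMeasurable (by fun_prop)
    · filter_upwards [ae_restrict_mem (measurableSet_Rpos d)] with x hx
      rw [Complex.norm_real, norm_prod]
      refine prod_le_one (fun _ _ => norm_nonneg _) fun l _ => ?_
      rw [Real.norm_of_nonneg (by positivity)]
      exact pow_le_one₀ (Real.exp_nonneg _) (Real.exp_le_one_iff.2 (by linarith [hx l]))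
  have h1 := ae_eq_zero_of_integral_mul_exp_eq_zero (G := fun x => (G x).re) hG.re fun n => by
    have := integral_re (𝕜 := ℂ) (hInt n)
    simp only [RCLike.re_to_complex, h n, Complex.re_ofReal_mul, Complex.zero_re] at this
    exact this
  have h2 := ae_eq_zero_of_integral_mul_exp_eq_zero (G := fun x => (G x).im) hG.im fun n => by
    have := integral_im (𝕜 := ℂ) (hInt n)
    simp only [RCLike.im_to_complex, h n, Complex.im_ofReal_mul, Complex.zero_im] at this
    exact this
  filter_upwards [h1, h2] with x hx hy
  exact Complex.ext hx hy

lemma prod_rpow_nonneg {d : ℕ} (γ : Fin d → ℝ) {x : Fin d → ℝ} (hx : x ∈ Rpos d) :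
    0 ≤ ∏ l, x l ^ γ l := prod_nonneg fun l _ => Real.rpow_nonneg (hx l).le _

lemma IsRapid.integrable_weight {d : ℕ} {f : (Fin d → ℝ) → ℂ} (hf : IsRapid f) {γ : Fin d → ℝ}
    (hγ : ∀ l, 0 ≤ γ l) :
    IntegrableOn (fun x => f x * ((∏ l, x l ^ γ l : ℝ) : ℂ)) (Rpos d) := by
  obtain ⟨C, -, hC⟩ := hf.weight_bound hγ
  refine Integrable.mono' (integrable_cauchyProd.integrableOn.const_mul C) (hf.aesm.mul ?_) ?_
  · refine (Complex.continuous_ofReal.comp (continuous_finsetProd _ fun l _ => ?_)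
      ).aestronglyMeasurable
    exact (Real.continuous_rpow_const (hγ l)).comp (continuous_apply l)
  · filter_upwards [ae_restrict_mem (measurableSet_Rpos d)] with x hx
    rw [norm_mul, Complex.norm_real, Real.norm_of_nonneg (prod_rpow_nonneg γ hx), mul_comm]
    exact hC x hx

lemma integrable_expProd_weight_complex {d : ℕ} {a γ : Fin d → ℝ} (ha : ∀ l, 0 < a l)
    (hγ : ∀ l, 0 ≤ γ l) :
    IntegrableOn (fun x => (expProd a x : ℂ) * ((∏ l, x l ^ γ l : ℝ) : ℂ)) (Rpos d) := by
  have := (expProd_integrable_weight ha hγ).ofReal (𝕜 := ℂ)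
  simpa [IntegrableOn] using this

lemma IsRapid.integral_HT_HT_mul_expProd {d : ℕ} {f : (Fin d → ℝ) → ℂ} (hf : IsRapid f)
    {a c γ : Fin d → ℝ} (hc : ∀ l, 0 < c l) (hγ : ∀ l, 0 ≤ γ l) (ha : ∀ l, 0 < a l) :
    ∫ t in Rpos d, _root_.HT c γ (_root_.HT c γ f) t *
        ((expProd a t : ℂ) * ((∏ l, t l ^ γ l : ℝ) : ℂ))
      = ∫ t in Rpos d, (((∏ l, c l ^ (-1 - γ l) : ℝ) : ℂ) * f t) *
        ((expProd a t : ℂ) * ((∏ l, t l ^ γ l : ℝ) : ℂ)) := by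
  have hE := integrable_expProd_weight_complex ha hγ
  have hE' : IntegrableOn (fun x => _root_.HT c γ (fun x => (expProd a x : ℂ)) x *
      ((∏ l, x l ^ γ l : ℝ) : ℂ)) (Rpos d) := by
    simp only [HT_expProd ha hγ, mul_assoc]
    exact (integrable_expProd_weight_complex (fun l => div_pos (hc l) (ha l)) hγ).const_mul _
  have h1 := HT_symm hc hγ ((hf.HT hc hγ).integrable_weight hγ) hE
  have h2 := HT_symm hc hγ (hf.integrable_weight hγ) hE'
  rw [h1]
  calc _ = ∫ t in Rpos d, _root_.HT c γ f t *
        (_root_.HT c γ (fun x => (expProd a x : ℂ)) t * ((∏ l, t l ^ γ l : ℝ) : ℂ)) := by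
        congr 1; ext t; ring
    _ = _ := by
        rw [h2]
        congr 1; ext t
        rw [HT_HT_expProd ha hc hγ]; ring

/-- Inversion formula for the Hankel–Clifford transform. -/
lemma IsRapid.HT_HT {d : ℕ} {f : (Fin d → ℝ) → ℂ} (hf : IsRapid f)
    {c γ : Fin d → ℝ} (hc : ∀ l, 0 < c l) (hγ : ∀ l, 0 ≤ γ l) :
    Set.EqOn (_root_.HT c γ (_root_.HT c γ f))
      (fun t => ((∏ l, c l ^ (-1 - γ l) : ℝ) : ℂ) * f t) (Rpos d) := by
  set κ : ℂ := ((∏ l, c l ^ (-1 - γ l) : ℝ) : ℂ)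
  have hHH := (hf.HT hc hγ).HT hc hγ
  set F : (Fin d → ℝ) → ℂ := _root_.HT c γ (_root_.HT c γ f) + fun t => (-κ) * f t with hF
  have hFr : IsRapid F := hHH.add (hf.const_mul _)
  have hInt : ∀ (n : Fin d → ℕ) {u : (Fin d → ℝ) → ℂ}, IsRapid u → IntegrableOn
      (fun t => u t * ((expProd (fun l => (n l : ℝ) + 1) t : ℂ) * ((∏ l, t l ^ γ l : ℝ) : ℂ)))
      (Rpos d) := by
    intro n u hu
    refine ((hu.integrable_weight hγ).bdd_mul (c := 1)
      (f := fun t => (expProd (fun l => (n l : ℝ) + 1) t : ℂ)) ?_ ?_).congr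
      (.of_forall fun t => ?_)
    · exact Continuous.aestronglyMeasurable (by unfold expProd; fun_prop)
    · filter_upwards [ae_restrict_mem (measurableSet_Rpos d)] with x hx
      rw [Complex.norm_real, expProd, norm_prod]
      refine prod_le_one (fun _ _ => norm_nonneg _) fun l _ => ?_
      rw [Real.norm_of_nonneg (by positivity)]
      have := hx l
      exact Real.exp_le_one_iff.2 (neg_nonpos.2 (by positivity))
    · ring
  have hae := ae_eq_zero_of_integral_mul_exp_eq_zero_complex (hInt 0 hFr) fun n => by
    have e := hf.integral_HT_HT_mul_expProd (a := fun l => (n l : ℝ) + 1) hc hγ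
      fun l => by positivity
    rw [← sub_eq_zero, ← integral_sub (hInt n hHH) (hInt n (hf.const_mul κ))] at e
    rw [← e]
    congr 1; ext t
    have : expProd (fun l => (n l : ℝ) + 1) t
        = (∏ l, Real.exp (-t l) ^ n l) * expProd (fun l => ((0 : Fin d → ℕ) l : ℝ) + 1) t := by
      unfold expProd
      rw [← prod_mul_distrib]
      refine prod_congr rfl fun l _ => ?_
      rw [← Real.exp_nat_mul, ← Real.exp_add]
      congr 1
      simp
      ring
    rw [this]
    simp only [hF, Pi.add_apply]
    push_cast
    ring
  have hF0 : F =ᵐ[volume.restrict (Rpos d)] 0 := by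
    filter_upwards [hae, ae_restrict_mem (measurableSet_Rpos d)] with x hx hxR
    have h1 : ((∏ l, x l ^ γ l : ℝ) : ℂ) ≠ 0 :=
      Complex.ofReal_ne_zero.2 (prod_pos fun l _ => Real.rpow_pos_of_pos (hxR l) _).ne'
    have h2 : ∀ a : Fin d → ℝ, (expProd a x : ℂ) ≠ 0 := fun a =>
      Complex.ofReal_ne_zero.2 (prod_pos fun l _ => Real.exp_pos _).ne'
    simpa [h1, h2, -Complex.ofReal_prod] using hx
  have := Measure.eqOn_open_of_ae_eq hF0 (isOpen_Rpos d) hFr.smooth.continuousOn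
    continuousOn_const
  intro t ht
  have h := this ht
  simp only [hF, Pi.add_apply, Pi.zero_apply] at h
  linear_combination h

lemma HT_conj {d : ℕ} (c γ : Fin d → ℝ) (f : (Fin d → ℝ) → ℂ) (t : Fin d → ℝ) :
    HT c γ (fun x => starRingEnd ℂ (f x)) t = starRingEnd ℂ (HT c γ f t) := by
  unfold HT
  rw [← integral_conj]
  simp

/-- Parseval's formula for the Hankel–Clifford transform. -/
lemma IsRapid.integral_norm_HT_sq {d : ℕ} {f : (Fin d → ℝ) → ℂ} (hf : IsRapid f)
    {c γ : Fin d → ℝ} (hc : ∀ l, 0 < c l) (hγ : ∀ l, 0 ≤ γ l) :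
    ∫ t in Rpos d, ‖_root_.HT c γ f t‖ ^ 2 * ∏ l, t l ^ γ l
      = (∏ l, c l ^ (-1 - γ l)) * ∫ t in Rpos d, ‖f t‖ ^ 2 * ∏ l, t l ^ γ l := by
  have hH := (hf.HT hc hγ).integrable_weight hγ
  have hconj : IntegrableOn (fun x => starRingEnd ℂ (_root_.HT c γ f x) *
      ((∏ l, x l ^ γ l : ℝ) : ℂ)) (Rpos d) := by
    refine (Complex.conjCLE.toContinuousLinearMap.integrable_comp hH).congr (.of_forall fun x => ?_)
    simp
  have h := HT_symm hc hγ (hf.integrable_weight hγ) hconj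
  apply Complex.ofReal_injective
  rw [Complex.ofReal_mul, ← integral_complex_ofReal, ← integral_complex_ofReal,
    ← integral_const_mul]
  have e1 : ∀ (w : ℂ) (r : ℝ), ((‖w‖ ^ 2 * r : ℝ) : ℂ) = w * (starRingEnd ℂ w * r) := fun w r => by
    rw [← mul_assoc, Complex.mul_conj']
    push_cast; ring
  simp only [e1]
  rw [h]
  refine setIntegral_congr_fun (measurableSet_Rpos d) fun t ht => ?_
  simp only [HT_conj, hf.HT_HT hc hγ ht, map_mul, Complex.conj_ofReal]
  ring

/-- The frequency parameter `|1 - z|⁻²` attached to the phase `z`. -/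
def freq {d : ℕ} (z : Fin d → ℂ) (l : Fin d) : ℝ := (‖1 - z l‖ ^ 2)⁻¹

lemma freq_pos {d : ℕ} {z : Fin d → ℂ} (hz : ∀ l, ‖z l‖ = 1 ∧ z l ≠ 1) (l : Fin d) :
    0 < freq z l :=
  inv_pos.2 (pow_pos (norm_pos_iff.2 (sub_ne_zero.2 (hz l).2.symm)) 2)

lemma freq_conj {d : ℕ} (z : Fin d → ℂ) : freq (fun l => starRingEnd ℂ (z l)) = freq z := by
  ext l
  have : 1 - starRingEnd ℂ (z l) = starRingEnd ℂ (1 - z l) := by simp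
  simp only [freq, this, RCLike.norm_conj]

lemma ofReal_freq {d : ℕ} (z : Fin d → ℂ) (l : Fin d) :
    (freq z l : ℂ) = ((1 - z l) * starRingEnd ℂ (1 - z l))⁻¹ := by
  rw [Complex.mul_conj', freq]; push_cast; rfl

lemma div_one_sub_sq_eq_neg_freq {d : ℕ} {z : Fin d → ℂ} (hz : ∀ l, ‖z l‖ = 1 ∧ z l ≠ 1)
    (l : Fin d) : z l / (1 - z l) ^ 2 = -(freq z l : ℂ) := by
  have h0 : 1 - z l ≠ 0 := sub_ne_zero.2 (hz l).2.symm
  have h0' : starRingEnd ℂ (1 - z l) ≠ 0 := (map_ne_zero _).2 h0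
  have h1 : z l * starRingEnd ℂ (z l) = 1 := by rw [Complex.mul_conj', (hz l).1]; simp
  rw [ofReal_freq, ← one_div, ← neg_div, div_eq_div_iff (pow_ne_zero 2 h0) (mul_ne_zero h0 h0')]
  simp only [map_sub, map_one]
  linear_combination -(1 - z l) * h1

lemma Jtrans_eq_HT {d : ℕ} {z : Fin d → ℂ} (hz : ∀ l, ‖z l‖ = 1 ∧ z l ≠ 1) (γ : Fin d → ℝ)
    (f : (Fin d → ℝ) → ℂ) :
    Jtrans z γ f = fun t => (∏ l, (1 - z l) ^ ((-1 : ℂ) - (γ l : ℂ))) * HT (freq z) γ f t := by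
  ext t
  unfold Jtrans HT
  congr 1
  refine setIntegral_congr_fun (measurableSet_Rpos d) fun x hx => ?_
  simp only [hk, Complex.ofReal_prod]
  congr 1
  refine prod_congr rfl fun l _ => ?_
  rw [mul_div_assoc, div_one_sub_sq_eq_neg_freq hz, Complex.ofReal_mul,
    Complex.ofReal_cpow (hx l).le, ← Kfun_neg]
  congr 2
  push_cast
  ring

lemma norm_prod_cpow_sq_mul {d : ℕ} {z : Fin d → ℂ} (hz : ∀ l, ‖z l‖ = 1 ∧ z l ≠ 1)
    (γ : Fin d → ℝ) : ‖∏ l, (1 - z l) ^ ((-1 : ℂ) - (γ l : ℂ))‖ ^ 2 *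
      ∏ l, freq z l ^ (-1 - γ l) = 1 := by
  rw [norm_prod, ← prod_pow, ← prod_mul_distrib]
  refine prod_eq_one fun l _ => ?_
  have h0 : 0 < ‖1 - z l‖ := norm_pos_iff.2 (sub_ne_zero.2 (hz l).2.symm)
  have e : (-1 : ℂ) - (γ l : ℂ) = ((-1 - γ l : ℝ) : ℂ) := by push_cast; rfl
  rw [e, Complex.norm_cpow_real, sq, ← Real.mul_rpow h0.le h0.le, ← sq,
    ← Real.mul_rpow (by positivity) (freq_pos hz l).le, freq, mul_inv_cancel₀ (by positivity),
    Real.one_rpow]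

end

/-- For `γ ∈ [0,∞)^d`, `z ∈ 𝕋^{(d)}`, `f ∈ S(ℝ^d₊)`: (a) `J_{z,γ}f ∈ S(ℝ^d₊)`;
(b) `J_{z,γ}` preserves the weighted `L²(t^γ dt)` norm; (c) for `γ = 0`,
`J_{z̄,0}(J_{z,0} f) = f` on `ℝ^d₊`. -/
theorem stmt5 {d : ℕ} (γ : Fin d → ℝ) (hγ : ∀ l, 0 ≤ γ l) (z : Fin d → ℂ)
    (hz : ∀ l, ‖z l‖ = 1 ∧ z l ≠ 1) (f : (Fin d → ℝ) → ℂ) (hf : IsSPlus f) :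
    IsSPlus (Jtrans z γ f) ∧
    (∫ t in Rpos d, ‖Jtrans z γ f t‖^2 * ∏ l, t l ^ γ l)
      = (∫ t in Rpos d, ‖f t‖^2 * ∏ l, t l ^ γ l) ∧
    (∀ t ∈ Rpos d,
      Jtrans (fun l => starRingEnd ℂ (z l)) (fun _ => 0) (Jtrans z (fun _ => 0) f) t = f t) := by
  have hr := hf.isRapid
  have hc := freq_pos hz
  refine ⟨?_, ?_, fun t ht => ?_⟩
  · rw [Jtrans_eq_HT hz]
    exact hr.isSPlus_HT hc hγ _
  · simp only [Jtrans_eq_HT hz, norm_mul, mul_pow, mul_assoc]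
    rw [integral_const_mul, hr.integral_norm_HT_sq hc hγ, ← mul_assoc,
      norm_prod_cpow_sq_mul hz, one_mul]
  · have hz' : ∀ l, ‖starRingEnd ℂ (z l)‖ = 1 ∧ starRingEnd ℂ (z l) ≠ 1 := fun l =>
      ⟨by rw [RCLike.norm_conj, (hz l).1],
        fun h => (hz l).2 (by simpa using congrArg (starRingEnd ℂ) h)⟩
    rw [Jtrans_eq_HT hz', Jtrans_eq_HT hz, freq_conj]
    simp only [HT_const_mul]
    rw [hr.HT_HT hc (fun _ => le_rfl) ht]
    simp only
    rw [← mul_assoc, ← mul_assoc, Complex.ofReal_prod, ← prod_mul_distrib, ← prod_mul_distrib,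
      prod_eq_one fun l _ => ?_, one_mul]
    have h0 : 1 - z l ≠ 0 := sub_ne_zero.2 (hz l).2.symm
    have h0' : starRingEnd ℂ (1 - z l) ≠ 0 := (map_ne_zero _).2 h0
    rw [sub_zero, Real.rpow_neg_one, Complex.ofReal_inv, ofReal_freq, Complex.ofReal_zero, sub_zero,
      Complex.cpow_neg_one, Complex.cpow_neg_one, inv_inv]
    simp only [map_sub, map_one] at h0' ⊢
    field_simp
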